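/- arXiv:2002.12072 — 2 statements merged into one kernel-verified Lean document; each statement's English description precedes it below -/
import Mathlib

section
/- Let p be a prime with p > 3 and p ≡ 3 (mod 4), and let b_n = Σ_{k=0}^{⌊n/3⌋} C(2k,k)·C(3k,k)·C(n,3k)·C(n+k,k)·(−3)^{n−3k} denote the Almkvist–Zudilin numbers. Then Σ_{n=0}^{p−1} b_n/(−3)^n ≡ Σ_{n=0}^{p−1} b_n/(−27)^n ≡ 0 (mod p²). -/
/-- A rational number is a `p`-integer if its denominator (in lowest terms)
is not divisible by `p`. -/
def isPInt (p : ℕ) (x : ℚ) : Prop := ¬ p ∣ x.den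

/-- For `p`-integers `u, v`, `u ≡ v (mod p^k)` means `(u - v)/p^k` is a `p`-integer. -/
def pCong (p k : ℕ) (u v : ℚ) : Prop := isPInt p ((u - v) / (p : ℚ) ^ k)

/-- The Almkvist–Zudilin numbers
`b_n = Σ_{k=0}^{⌊n/3⌋} C(2k,k)·C(3k,k)·C(n,3k)·C(n+k,k)·(−3)^{n−3k}`. -/
def az (n : ℕ) : ℤ :=
  ∑ k ∈ Finset.range (n / 3 + 1),
    ((2 * k).choose k : ℤ) * ((3 * k).choose k : ℤ) * (n.choose (3 * k) : ℤ) *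
      ((n + k).choose k : ℤ) * (-3 : ℤ) ^ (n - 3 * k)

/-- The falling product `(x + k) ⋯ (x - 3 k + 1) / k!⁴`. -/
def lowProd (x : ℚ) : ℕ → ℚ
  | 0 => 1
  | k + 1 => lowProd x k * ((x + k + 1) * (x - 3 * k) * (x - 3 * k - 1) * (x - 3 * k - 2)) /
      ((k : ℚ) + 1) ^ 4

/-- The falling product `(x + 3 k) ⋯ (x - k + 1) / k!⁴`. -/
def highProd (x : ℚ) : ℕ → ℚ
  | 0 => 1
  | k + 1 => highProd x k *
      ((x + 3 * k + 1) * (x + 3 * k + 2) * (x + 3 * k + 3) * (x - k)) / ((k : ℚ) + 1) ^ 4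

/-- The shifted Legendre coefficient `(-1)^k C(x, k) C(x + k, k)`. -/
def legendreCoeff (x : ℚ) : ℕ → ℚ
  | 0 => 1
  | k + 1 => legendreCoeff x k * (-(x - k) * (x + k + 1)) / ((k : ℚ) + 1) ^ 2

lemma lowProd_shift (x : ℚ) (k : ℕ) :
    lowProd (x + 1) k * (x + 1 - 3 * k) = lowProd x k * (x + 1 + k) := by
  induction k with
  | zero => simp [lowProd]
  | succ k ih =>
    have hk : (k : ℚ) + 1 ≠ 0 := by positivity
    simp only [lowProd]
    push_cast
    field_simp
    linear_combination ((x + k + 2) * (x - 3 * k) * (x - 3 * k - 1) * (x - 3 * k - 2)) * ih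

lemma highProd_shift (x : ℚ) (k : ℕ) :
    highProd (x + 1) k * (x + 1 - k) = highProd x k * (x + 1 + 3 * k) := by
  induction k with
  | zero => simp [highProd]
  | succ k ih =>
    have hk : (k : ℚ) + 1 ≠ 0 := by positivity
    simp only [highProd]
    push_cast
    field_simp
    linear_combination
      ((x + 3 * k + 2) * (x + 3 * k + 3) * (x + 3 * k + 4) * (x - k)) * ih

lemma legendreCoeff_shift (x : ℚ) (k : ℕ) :
    legendreCoeff (x + 1) k * (x + 1 - k) = legendreCoeff x k * (x + 1 + k) := by
  induction k with
  | zero => simp [legendreCoeff]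
  | succ k ih =>
    have hk : (k : ℚ) + 1 ≠ 0 := by positivity
    simp only [legendreCoeff]
    push_cast
    field_simp
    linear_combination (-(x - k) * (x + k + 2)) * ih

lemma lowProd_eq_zero {n k : ℕ} (h : n < 3 * k) : lowProd n k = 0 := by
  induction k with
  | zero => omega
  | succ k ih =>
    by_cases hk : n < 3 * k
    · simp [lowProd, ih hk]
    · obtain rfl | rfl | rfl : n = 3 * k ∨ n = 3 * k + 1 ∨ n = 3 * k + 2 := by omega
      all_goals simp [lowProd]

lemma highProd_eq_zero {n k : ℕ} (h : n < k) : highProd n k = 0 := by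
  induction k with
  | zero => omega
  | succ k ih =>
    obtain hk | rfl : n < k ∨ n = k := by omega
    · simp [highProd, ih hk]
    · simp [highProd]

lemma legendreCoeff_eq_zero {n k : ℕ} (h : n < k) : legendreCoeff n k = 0 := by
  induction k with
  | zero => omega
  | succ k ih =>
    obtain hk | rfl : n < k ∨ n = k := by omega
    · simp [legendreCoeff, ih hk]
    · simp [legendreCoeff]

lemma sum_lowProd (k n : ℕ) :
    ∑ i ∈ Finset.range n, lowProd i k = lowProd n k * (n - 3 * k) / (4 * k + 1) := by
  have hk : (4 * k + 1 : ℚ) ≠ 0 := by positivity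
  induction n with
  | zero =>
    rcases Nat.eq_zero_or_pos k with rfl | hpos
    · simp
    · have h := lowProd_eq_zero (n := 0) (k := k) (by omega)
      simp_all
  | succ n ih =>
    rw [Finset.sum_range_succ, ih]
    push_cast
    field_simp
    linear_combination -lowProd_shift n k

lemma sum_highProd (k n : ℕ) :
    ∑ i ∈ Finset.range n, highProd i k = highProd n k * (n - k) / (4 * k + 1) := by
  have hk : (4 * k + 1 : ℚ) ≠ 0 := by positivity
  induction n with
  | zero =>
    rcases Nat.eq_zero_or_pos k with rfl | hpos
    · simp
    · have h := highProd_eq_zero (n := 0) (k := k) (by omega)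
      simp_all
  | succ n ih =>
    rw [Finset.sum_range_succ, ih]
    push_cast
    field_simp
    linear_combination -highProd_shift n k

lemma lowProd_recurrence_partial (x : ℚ) (K : ℕ) :
    ∑ k ∈ Finset.range (K + 1), (-1 / 27 : ℚ) ^ k * (3 * (x + 2) ^ 3 * lowProd (x + 2) k
      - (2 * x + 3) * (7 * (x + 1) ^ 2 + 7 * (x + 1) + 3) * lowProd (x + 1) k
      + 27 * (x + 1) ^ 3 * lowProd x k) =
    (-1 / 27 : ℚ) ^ K * (4 * (4 * x + 5) * lowProd (x + 1) K
      * (x + 1 - 3 * K) * (x - 3 * K)) := by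
  induction K with
  | zero => simp [lowProd]; ring
  | succ K ih =>
    have hK : (K : ℚ) + 1 ≠ 0 := by positivity
    have h2 : lowProd (x + 2) (K + 1) = lowProd (x + 1) K * ((x + K + 3) * (x + K + 2)
        * (x + 1 - 3 * K) * (x - 3 * K)) / ((K : ℚ) + 1) ^ 4 := by
      have h := lowProd_shift (x + 1) K
      rw [show x + 1 + 1 = x + 2 by ring] at h
      simp only [lowProd]
      field_simp
      linear_combination ((x + K + 3) * (x + 1 - 3 * K) * (x - 3 * K)) * h
    have h0 : lowProd x (K + 1) = lowProd (x + 1) K * ((x + 1 - 3 * K) * (x - 3 * K)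
        * (x - 3 * K - 1) * (x - 3 * K - 2)) / ((K : ℚ) + 1) ^ 4 := by
      have h := lowProd_shift x K
      simp only [lowProd]
      field_simp
      linear_combination -((x - 3 * K) * (x - 3 * K - 1) * (x - 3 * K - 2)) * h
    rw [Finset.sum_range_succ, ih, h2, h0]
    simp only [lowProd, pow_succ (-1 / 27 : ℚ)]
    push_cast
    field_simp
    ring

lemma highProd_recurrence_partial (x : ℚ) (K : ℕ) :
    ∑ k ∈ Finset.range (K + 1), (-1 / 27 : ℚ) ^ k * (27 * (x + 2) ^ 3 * highProd (x + 2) k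
      - (2 * x + 3) * (7 * (x + 1) ^ 2 + 7 * (x + 1) + 3) * highProd (x + 1) k
      + 3 * (x + 1) ^ 3 * highProd x k) =
    (-1 / 27 : ℚ) ^ K * (4 * (4 * x + 7) * highProd (x + 1) K
      * (x + 2 + 3 * K) * (x + 3 + 3 * K)) := by
  induction K with
  | zero => simp [highProd]; ring
  | succ K ih =>
    have hK : (K : ℚ) + 1 ≠ 0 := by positivity
    have h2 : highProd (x + 2) (K + 1) = highProd (x + 1) K * ((x + 3 * K + 2) * (x + 3 * K + 3)
        * (x + 3 * K + 4) * (x + 3 * K + 5)) / ((K : ℚ) + 1) ^ 4 := by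
      have h := highProd_shift (x + 1) K
      rw [show x + 1 + 1 = x + 2 by ring] at h
      simp only [highProd]
      field_simp
      linear_combination ((x + 3 * K + 3) * (x + 3 * K + 4) * (x + 3 * K + 5)) * h
    have h0 : highProd x (K + 1) = highProd (x + 1) K * ((x + 1 - K) * (x - K)
        * (x + 3 * K + 2) * (x + 3 * K + 3)) / ((K : ℚ) + 1) ^ 4 := by
      have h := highProd_shift x K
      simp only [highProd]
      field_simp
      linear_combination -((x - K) * (x + 3 * K + 2) * (x + 3 * K + 3)) * h
    rw [Finset.sum_range_succ, ih, h2, h0]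
    simp only [highProd, pow_succ (-1 / 27 : ℚ)]
    push_cast
    field_simp
    ring

/-- Both product sums satisfy the Almkvist–Zudilin recurrence, hence agree up to a power of 9. -/
lemma sum_lowProd_eq_sum_highProd (N n : ℕ) (h : n < N) :
    ∑ k ∈ Finset.range N, (-1 / 27 : ℚ) ^ k * lowProd n k =
      9 ^ n * ∑ k ∈ Finset.range N, (-1 / 27 : ℚ) ^ k * highProd n k := by
  induction n using Nat.twoStepInduction with
  | zero =>
    obtain ⟨M, rfl⟩ : ∃ M, N = M + 1 := ⟨N - 1, by omega⟩
    rw [Finset.sum_range_succ', Finset.sum_range_succ', Finset.sum_eq_zero, Finset.sum_eq_zero]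
    · simp [lowProd, highProd]
    · intro k _
      rw [highProd_eq_zero (by omega), mul_zero]
    · intro k _
      rw [lowProd_eq_zero (by omega), mul_zero]
  | one =>
    obtain ⟨M, rfl⟩ : ∃ M, N = M + 1 + 1 := ⟨N - 2, by omega⟩
    rw [Finset.sum_range_succ', Finset.sum_range_succ', Finset.sum_range_succ',
      Finset.sum_range_succ', Finset.sum_eq_zero, Finset.sum_eq_zero]
    · simp [lowProd, highProd]
      norm_num
    · intro k _
      rw [highProd_eq_zero (by omega), mul_zero]
    · intro k _
      rw [lowProd_eq_zero (by omega), mul_zero]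
  | more n ih0 ih1 =>
    obtain ⟨M, rfl⟩ : ∃ M, N = M + 1 := ⟨N - 1, by omega⟩
    have hl := lowProd_recurrence_partial n M
    have hh := highProd_recurrence_partial n M
    have zl := lowProd_eq_zero (n := n + 1) (k := M) (by omega)
    have zh := highProd_eq_zero (n := n + 1) (k := M) (by omega)
    have i0 := ih0 (by omega)
    have i1 := ih1 (by omega)
    have split (a b c : ℚ) (f g h : ℕ → ℚ) :
        ∑ k ∈ Finset.range (M + 1), (-1 / 27 : ℚ) ^ k * (a * f k - b * g k + c * h k) =
          a * ∑ k ∈ Finset.range (M + 1), (-1 / 27 : ℚ) ^ k * f k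
          - b * ∑ k ∈ Finset.range (M + 1), (-1 / 27 : ℚ) ^ k * g k
          + c * ∑ k ∈ Finset.range (M + 1), (-1 / 27 : ℚ) ^ k * h k := by
      simp only [Finset.mul_sum, ← Finset.sum_sub_distrib, ← Finset.sum_add_distrib]
      exact Finset.sum_congr rfl fun k _ => by ring
    push_cast at zl zh i0 i1 ⊢
    rw [zl, split, i0, i1] at hl
    rw [zh, split] at hh
    have hn : (3 * ((n : ℚ) + 2) ^ 3) ≠ 0 := by positivity
    apply mul_left_cancel₀ hn
    rw [pow_succ] at hl
    rw [pow_add]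
    linear_combination hl - 9 * 9 ^ n * hh

lemma lowProd_eq_factorial (k j : ℕ) :
    lowProd (3 * k + j) k =
      (4 * k + j).factorial / (j.factorial * (k.factorial : ℚ) ^ 4) := by
  induction k generalizing j with
  | zero =>
    have := Nat.factorial_ne_zero j
    simp [lowProd]
    field_simp
  | succ k ih =>
    have h := ih (j + 3)
    have e : (3 * ((k + 1 : ℕ) : ℚ) + j) = 3 * k + (j + 3 : ℕ) := by push_cast; ring
    have hk := Nat.factorial_ne_zero k
    have hj := Nat.factorial_ne_zero j
    rw [e, lowProd, h, show 4 * (k + 1) + j = (4 * k + (j + 3)) + 1 by ring,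
      Nat.factorial_succ (4 * k + (j + 3)), Nat.factorial_succ k,
      Nat.factorial_succ (j + 2), Nat.factorial_succ (j + 1), Nat.factorial_succ j]
    push_cast
    field_simp
    ring

lemma choose_prod_eq_lowProd {n k : ℕ} (h : 3 * k ≤ n) :
    ((2 * k).choose k : ℚ) * (3 * k).choose k * n.choose (3 * k) * (n + k).choose k =
      lowProd n k := by
  obtain ⟨j, rfl⟩ := Nat.exists_eq_add_of_le h
  have hk := Nat.factorial_ne_zero k
  have h2 := Nat.factorial_ne_zero (2 * k)
  have h3 := Nat.factorial_ne_zero (3 * k)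
  have hj := Nat.factorial_ne_zero j
  have hn := Nat.factorial_ne_zero (3 * k + j)
  push_cast
  rw [lowProd_eq_factorial, Nat.cast_add_choose,
    show (3 * k + j + k).choose k = (k + (3 * k + j)).choose k by congr 1; ring,
    Nat.cast_add_choose,
    show (2 * k).choose k = (k + k).choose k by rw [two_mul],
    show (3 * k).choose k = (k + 2 * k).choose k by congr 1; ring,
    Nat.cast_add_choose, Nat.cast_add_choose, show k + k = 2 * k by ring,
    show k + 2 * k = 3 * k by ring, show k + (3 * k + j) = 4 * k + j by ring]
  field_simp

lemma az_eq_sum_lowProd {N n : ℕ} (h : n < N) :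
    (az n : ℚ) = (-3) ^ n * ∑ k ∈ Finset.range N, (-1 / 27 : ℚ) ^ k * lowProd n k := by
  rw [← Finset.sum_subset (Finset.range_mono (show n / 3 + 1 ≤ N by omega)), az, Finset.mul_sum]
  · push_cast
    refine Finset.sum_congr rfl fun k hk => ?_
    have hk' : 3 * k ≤ n := by
      have := Finset.mem_range.mp hk
      omega
    obtain ⟨j, rfl⟩ := Nat.exists_eq_add_of_le hk'
    have hw : (-1 / 27 : ℚ) ^ k * (-3) ^ (3 * k) = 1 := by
      rw [pow_mul, ← mul_pow]
      norm_num
    rw [choose_prod_eq_lowProd hk', Nat.add_sub_cancel_left, pow_add]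
    linear_combination -(lowProd (3 * k + j : ℕ) k * (-3) ^ j) * hw
  · intro k _ hk
    rw [Finset.mem_range] at hk
    rw [lowProd_eq_zero (by omega), mul_zero]

lemma sum_az_div_neg_three (N : ℕ) :
    ∑ n ∈ Finset.range N, (az n : ℚ) / (-3) ^ n =
      ∑ k ∈ Finset.range N, (-1 / 27 : ℚ) ^ k * (lowProd N k * (N - 3 * k)) / (4 * k + 1) := by
  calc
    _ = ∑ n ∈ Finset.range N, ∑ k ∈ Finset.range N, (-1 / 27 : ℚ) ^ k * lowProd n k := by
      refine Finset.sum_congr rfl fun n hn => ?_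
      rw [az_eq_sum_lowProd (Finset.mem_range.mp hn), mul_div_cancel_left₀ _ (by simp)]
    _ = _ := by
      rw [Finset.sum_comm]
      simp only [← Finset.mul_sum, sum_lowProd, mul_div_assoc]

lemma sum_az_div_neg_twentySeven (N : ℕ) :
    ∑ n ∈ Finset.range N, (az n : ℚ) / (-27) ^ n =
      ∑ k ∈ Finset.range N, (-1 / 27 : ℚ) ^ k * (highProd N k * (N - k)) / (4 * k + 1) := by
  calc
    _ = ∑ n ∈ Finset.range N, ∑ k ∈ Finset.range N, (-1 / 27 : ℚ) ^ k * highProd n k := by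
      refine Finset.sum_congr rfl fun n hn => ?_
      rw [az_eq_sum_lowProd (Finset.mem_range.mp hn),
        sum_lowProd_eq_sum_highProd N n (Finset.mem_range.mp hn), ← mul_assoc, ← mul_pow,
        show (-3 * 9 : ℚ) = -27 by norm_num, mul_div_cancel_left₀ _ (by simp)]
    _ = _ := by
      rw [Finset.sum_comm]
      simp only [← Finset.mul_sum, sum_highProd, mul_div_assoc]

lemma sum_legendreCoeff_partial (m K : ℕ) :
    (m + 1) * ∑ k ∈ Finset.range (K + 1), ((4 * m + 5) * (legendreCoeff (m + 1) k / (4 * k + 1))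
      - (4 * m + 3) * (legendreCoeff m k / (4 * k + 1))) =
    2 * legendreCoeff m K * (m + 1 + K) := by
  induction K with
  | zero => simp [legendreCoeff]; ring
  | succ K ih =>
    have hK : (K : ℚ) + 1 ≠ 0 := by positivity
    have h4 : (4 * (K + 1) + 1 : ℚ) ≠ 0 := by positivity
    have h1 : legendreCoeff ((m : ℚ) + 1) (K + 1) = legendreCoeff m K *
        (-(m + 1 + K) * (m + K + 2)) / ((K : ℚ) + 1) ^ 2 := by
      simp only [legendreCoeff]
      field_simp
      linear_combination (-(m + K + 2 : ℚ)) * legendreCoeff_shift m K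
    rw [Finset.sum_range_succ, mul_add, ih, h1]
    simp only [legendreCoeff]
    push_cast
    field_simp
    ring

lemma sum_legendreCoeff_succ (m N : ℕ) (h : m + 1 < N) :
    (4 * m + 5) * ∑ k ∈ Finset.range N, legendreCoeff (m + 1 : ℕ) k / (4 * k + 1) =
      (4 * m + 3) * ∑ k ∈ Finset.range N, legendreCoeff m k / (4 * k + 1) := by
  obtain ⟨K, rfl⟩ : ∃ K, N = K + 1 := ⟨N - 1, by omega⟩
  have hm : (m + 1 : ℚ) ≠ 0 := by positivity
  have hs := sum_legendreCoeff_partial m K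
  rw [legendreCoeff_eq_zero (by omega), mul_zero, zero_mul, mul_eq_zero, or_iff_right hm,
    Finset.sum_sub_distrib, ← Finset.mul_sum, ← Finset.mul_sum, sub_eq_zero] at hs
  exact_mod_cast hs

section Integrality

variable {p : ℕ} [Fact p.Prime]

lemma isPInt_iff_mem_integer {x : ℚ} : isPInt p x ↔ x ∈ (Rat.padicValuation p).integer := by
  rw [isPInt, Valuation.mem_integer_iff, Rat.padicValuation_le_one_iff]

lemma int_inv_mem_integer {b : ℤ} (h : ¬ (p : ℤ) ∣ b) :
    (b : ℚ)⁻¹ ∈ (Rat.padicValuation p).integer := by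
  rw [Valuation.mem_integer_iff, map_inv₀, Rat.padicValuation_cast,
    Int.padicValuation_eq_one_iff.mpr h, inv_one]

variable (p) in
/-- The rational numbers that are `p ^ j` times a `p`-integer. -/
def pMultiples (j : ℕ) : AddSubgroup ℚ :=
  (Rat.padicValuation p).integer.toAddSubgroup.map (AddMonoidHom.mulLeft ((p : ℚ) ^ j))

lemma mem_pMultiples {j : ℕ} {x : ℚ} :
    x ∈ pMultiples p j ↔ ∃ y ∈ (Rat.padicValuation p).integer, (p : ℚ) ^ j * y = x :=
  Iff.rfl

lemma mem_pMultiples_zero {x : ℚ} :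
    x ∈ pMultiples p 0 ↔ x ∈ (Rat.padicValuation p).integer := by
  simp [mem_pMultiples]

lemma mul_mem_pMultiples {i j : ℕ} {x y : ℚ} (hx : x ∈ pMultiples p i)
    (hy : y ∈ pMultiples p j) : x * y ∈ pMultiples p (i + j) := by
  obtain ⟨a, ha, rfl⟩ := mem_pMultiples.mp hx
  obtain ⟨b, hb, rfl⟩ := mem_pMultiples.mp hy
  exact mem_pMultiples.mpr ⟨a * b, mul_mem ha hb, by ring⟩

lemma int_mem_pMultiples_zero (a : ℤ) : (a : ℚ) ∈ pMultiples p 0 :=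
  mem_pMultiples_zero.mpr (intCast_mem _ a)

lemma int_mem_pMultiples_one {a : ℤ} (h : (p : ℤ) ∣ a) : (a : ℚ) ∈ pMultiples p 1 := by
  obtain ⟨c, rfl⟩ := h
  exact mem_pMultiples.mpr ⟨c, intCast_mem _ c, by push_cast; ring⟩

lemma prime_mem_pMultiples_one : (p : ℚ) ∈ pMultiples p 1 :=
  mem_pMultiples.mpr ⟨1, one_mem _, by ring⟩

lemma div_mem_pMultiples {j : ℕ} {x : ℚ} (hx : x ∈ pMultiples p j) {b : ℤ}
    (hb : ¬ (p : ℤ) ∣ b) : x / b ∈ pMultiples p j := by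
  rw [div_eq_mul_inv]
  exact mul_mem_pMultiples hx (mem_pMultiples_zero.mpr (int_inv_mem_integer hb))

lemma pMultiples_anti {i j : ℕ} (h : i ≤ j) : pMultiples p j ≤ pMultiples p i := by
  intro x hx
  obtain ⟨y, hy, rfl⟩ := mem_pMultiples.mp hx
  obtain ⟨d, rfl⟩ := Nat.exists_eq_add_of_le h
  exact mem_pMultiples.mpr ⟨p ^ d * y, mul_mem (pow_mem (natCast_mem _ p) d) hy, by ring⟩

lemma pCong_iff {j : ℕ} {x y : ℚ} : pCong p j x y ↔ x - y ∈ pMultiples p j := by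
  have hp : (p : ℚ) ≠ 0 := Nat.cast_ne_zero.mpr (Fact.out : p.Prime).ne_zero
  rw [pCong, isPInt_iff_mem_integer, mem_pMultiples]
  constructor
  · intro h
    exact ⟨_, h, by field_simp⟩
  · rintro ⟨z, hz, h⟩
    rw [← h]
    convert hz using 1
    field_simp

lemma not_dvd_succ_pow {k : ℕ} (hk : k + 1 < p) (e : ℕ) :
    ¬ (p : ℤ) ∣ ((k : ℤ) + 1) ^ e := by
  intro h
  have h1 := Int.Prime.dvd_pow' (Fact.out : p.Prime) h
  exact absurd (Nat.le_of_dvd k.succ_pos (by exact_mod_cast h1)) (by omega)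

lemma not_dvd_twentySeven (hp : 3 < p) : ¬ (p : ℤ) ∣ 27 := by
  intro h
  have h1 : p ∣ 3 ^ 3 := by exact_mod_cast h
  exact absurd (Nat.le_of_dvd (by norm_num) ((Fact.out : p.Prime).dvd_of_dvd_pow h1)) (by omega)

lemma not_dvd_denominator (hp : 3 < p) {k : ℕ} (hk : k + 1 < p) :
    ¬ (p : ℤ) ∣ 27 * ((k : ℤ) + 1) ^ 4 := fun h =>
  ((Nat.prime_iff_prime_int.mp Fact.out).dvd_or_dvd h).elim (not_dvd_twentySeven hp)
    (not_dvd_succ_pow hk 4)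

lemma legendreCoeff_mem (m : ℕ) {k : ℕ} (hk : k < p) : legendreCoeff m k ∈ pMultiples p 0 := by
  induction k with
  | zero => simpa [legendreCoeff] using int_mem_pMultiples_zero (p := p) 1
  | succ k ih =>
    have h := div_mem_pMultiples (mul_mem_pMultiples (ih (by omega))
      (int_mem_pMultiples_zero (-(m - k) * (m + k + 1)))) (not_dvd_succ_pow hk 2)
    convert h using 1
    simp only [legendreCoeff]
    push_cast
    ring

/-- A hypergeometric sequence starting at `p` whose term ratio is congruent to that of the
Legendre coefficients is congruent to `p` times those coefficients modulo `p ^ 2`. -/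
lemma sub_legendreCoeff_mem (hp : 3 < p) (m : ℕ) (L : ℕ → ℚ) (N : ℕ → ℤ) (h0 : L 0 = p)
    (hL : ∀ k, L (k + 1) = L k * N k / (27 * ((k : ℚ) + 1) ^ 4))
    (hN : ∀ k : ℕ, (p : ℤ) ∣ N k + 27 * (m - k) * (m + k + 1) * (k + 1) ^ 2)
    {k : ℕ} (hk : k < p) : L k - p * legendreCoeff m k ∈ pMultiples p 2 := by
  induction k with
  | zero => simp [h0, legendreCoeff]
  | succ k ih =>
    have hd := not_dvd_denominator hp hk
    have h1 := div_mem_pMultiples (mul_mem_pMultiples (ih (by omega))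
      (int_mem_pMultiples_zero (N k))) hd
    have h2 := div_mem_pMultiples (mul_mem_pMultiples (mul_mem_pMultiples
      (prime_mem_pMultiples_one (p := p)) (legendreCoeff_mem m (by omega : k < p)))
      (int_mem_pMultiples_one (hN k))) hd
    convert add_mem h1 h2 using 1
    rw [hL]
    simp only [legendreCoeff]
    push_cast
    field_simp
    ring

lemma sum_legendreCoeff_mem (h4 : p % 4 = 3) (hp : 3 < p) {m : ℕ} (hm : 3 * m < p) :
    ∑ k ∈ Finset.range p, legendreCoeff m k / (4 * k + 1) ∈
      pMultiples p (if p < 4 * m then 1 else 0) := by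
  induction m with
  | zero =>
    obtain ⟨M, rfl⟩ : ∃ M, p = M + 1 := ⟨p - 1, by omega⟩
    rw [Finset.sum_range_succ', Finset.sum_eq_zero]
    · simpa [legendreCoeff] using int_mem_pMultiples_zero (p := M + 1) 1
    · intro k _
      rw [legendreCoeff_eq_zero (by omega), zero_div]
  | succ m ih =>
    have hb : ¬ (p : ℤ) ∣ 4 * m + 5 := by
      rintro ⟨c, hc⟩
      have hc0 : 0 < c := by
        by_contra! hneg
        nlinarith
      have hc3 : c < 3 := by
        by_contra! hge
        nlinarith
      interval_cases c <;> omega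
    have e : ∑ k ∈ Finset.range p, legendreCoeff (m + 1 : ℕ) k / (4 * k + 1) =
        (∑ k ∈ Finset.range p, legendreCoeff m k / (4 * k + 1)) * ((4 * m + 3 : ℤ) : ℚ) /
          ((4 * m + 5 : ℤ) : ℚ) := by
      have hne : (4 * m + 5 : ℚ) ≠ 0 := by positivity
      push_cast
      rw [eq_div_iff hne, mul_comm, ← Nat.cast_succ, sum_legendreCoeff_succ m p (by omega)]
      ring
    rw [e]
    refine div_mem_pMultiples ?_ hb
    by_cases hlt : p < 4 * m
    · rw [if_pos hlt] at ih
      rw [if_pos (by omega)]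
      exact mul_mem_pMultiples (ih (by omega)) (int_mem_pMultiples_zero _)
    · rw [if_neg hlt] at ih
      split_ifs with hs
      · exact mul_mem_pMultiples (ih (by omega)) (int_mem_pMultiples_one ⟨1, by omega⟩)
      · exact mul_mem_pMultiples (ih (by omega)) (int_mem_pMultiples_zero _)

lemma dvd_ratio_of_int_cast (hp : 3 < p) (N k : ℤ)
    (hN : ((N : ℤ) : ZMod p) = (k + 1) ^ 2 * (3 * (3 * k + 1) * (3 * k + 2))) :
    (p : ℤ) ∣ N + 27 * ((p / 3 : ℕ) - k) * ((p / 3 : ℕ) + k + 1) * (k + 1) ^ 2 := by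
  have h3 : p % 3 ≠ 0 := fun h => by
    have := (Nat.prime_dvd_prime_iff_eq Nat.prime_three (Fact.out : p.Prime)).mp
      (Nat.dvd_of_mod_eq_zero h)
    omega
  obtain ⟨m, hm⟩ : ∃ m, p / 3 = m := ⟨_, rfl⟩
  have key : (3 * m + 1 : ZMod p) * (3 * m + 2) = 0 := by
    obtain h | h : 3 * m + 1 = p ∨ 3 * m + 2 = p := by omega
    all_goals
      have hz := congrArg (Nat.cast (R := ZMod p)) h
      push_cast at hz
      simp [hz]
  rw [hm, ← ZMod.intCast_zmod_eq_zero_iff_dvd]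
  push_cast
  rw [hN]
  linear_combination 3 * (k + 1 : ZMod p) ^ 2 * key

lemma lowProd_congr (hp : 3 < p) {k : ℕ} (hk : k < p) :
    (-1 / 27 : ℚ) ^ k * (lowProd p k * (p - 3 * k)) - p * legendreCoeff (p / 3 : ℕ) k ∈
      pMultiples p 2 := by
  refine sub_legendreCoeff_mem hp (p / 3)
    (fun k => (-1 / 27 : ℚ) ^ k * (lowProd p k * (p - 3 * k)))
    (fun k => -(p + k + 1) * (p - 3 * k - 1) * (p - 3 * k - 2) * (p - 3 * k - 3))
    (by simp [lowProd]) (fun k => ?_) (fun k => dvd_ratio_of_int_cast hp _ _ ?_) hk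
  · simp only [lowProd, pow_succ (-1 / 27 : ℚ)]
    push_cast
    field_simp
    ring
  · push_cast
    rw [ZMod.natCast_self]
    ring

lemma highProd_succ (p k : ℕ) :
    (-1 / 27 : ℚ) ^ (k + 1) * (highProd p (k + 1) * (p - (k + 1 : ℕ))) =
      (-1 / 27 : ℚ) ^ k * (highProd p k * (p - k)) *
        ((-(p + 3 * k + 1) * (p + 3 * k + 2) * (p + 3 * k + 3) * (p - k - 1) : ℤ) : ℚ) /
          (27 * ((k : ℚ) + 1) ^ 4) := by
  simp only [highProd, pow_succ (-1 / 27 : ℚ)]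
  push_cast
  field_simp
  ring

lemma highProd_congr (hp : 3 < p) {k : ℕ} (hk : k < p) :
    (-1 / 27 : ℚ) ^ k * (highProd p k * (p - k)) - p * legendreCoeff (p / 3 : ℕ) k ∈
      pMultiples p 2 := by
  refine sub_legendreCoeff_mem hp (p / 3)
    (fun k => (-1 / 27 : ℚ) ^ k * (highProd p k * (p - k))) _
    (by simp [highProd]) (fun k => highProd_succ p k) (fun k => dvd_ratio_of_int_cast hp _ _ ?_) hk
  push_cast
  rw [ZMod.natCast_self]
  ring

lemma highProd_mem (hp : 3 < p) {k : ℕ} (hk : k < p) :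
    (-1 / 27 : ℚ) ^ k * (highProd p k * (p - k)) ∈ pMultiples p (1 + 3 * k / p) := by
  induction k with
  | zero => simpa [highProd] using prime_mem_pMultiples_one
  | succ k ih =>
    have hd := not_dvd_denominator hp hk
    have hden : 27 * ((k : ℚ) + 1) ^ 4 = ((27 * ((k : ℤ) + 1) ^ 4 : ℤ) : ℚ) := by push_cast; rfl
    rw [highProd_succ, hden]
    have step (e : ℕ)
        (he : ((-(p + 3 * k + 1) * (p + 3 * k + 2) * (p + 3 * k + 3) * (p - k - 1) : ℤ) : ℚ) ∈
          pMultiples p e) :=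
      div_mem_pMultiples (mul_mem_pMultiples (ih (by omega)) he) hd
    have hp0 : 0 < p := by omega
    by_cases hq : 3 * (k + 1) / p = 3 * k / p
    · rw [hq]
      exact step 0 (int_mem_pMultiples_zero _)
    · have hlt : 3 * k / p < 3 * (k + 1) / p :=
        lt_of_le_of_ne (Nat.div_le_div_right (by omega)) (Ne.symm hq)
      set q := 3 * (k + 1) / p with hqd
      have h1 : q * p ≤ 3 * (k + 1) := Nat.div_mul_le_self _ _
      have h2 : 3 * k < q * p := (Nat.div_lt_iff_lt_mul hp0).mp hlt
      have h3 : q ≤ 3 * k / p + 1 := by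
        calc q ≤ (3 * k + p) / p := Nat.div_le_div_right (by omega)
          _ = _ := Nat.add_div_right _ hp0
      have hdvd : (p : ℤ) ∣
          -(p + 3 * k + 1) * (p + 3 * k + 2) * (p + 3 * k + 3) * (p - k - 1) := by
        have hqz : (q * p : ℤ) = (q * p : ℕ) := by push_cast; rfl
        obtain h | h | h : q * p = 3 * k + 1 ∨ q * p = 3 * k + 2 ∨ q * p = 3 * k + 3 := by omega
        · have : (p : ℤ) ∣ p + 3 * k + 1 := ⟨q + 1, by rw [h] at hqz; push_cast at hqz; linarith⟩
          exact (((dvd_neg.mpr this).mul_right _).mul_right _).mul_right _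
        · have : (p : ℤ) ∣ p + 3 * k + 2 := ⟨q + 1, by rw [h] at hqz; push_cast at hqz; linarith⟩
          exact ((this.mul_left _).mul_right _).mul_right _
        · have : (p : ℤ) ∣ p + 3 * k + 3 := ⟨q + 1, by rw [h] at hqz; push_cast at hqz; linarith⟩
          exact (this.mul_left _).mul_right _
      exact pMultiples_anti (by omega) (step 1 (int_mem_pMultiples_one hdvd))

lemma div_succ_mem (hp : 3 < p) (h4 : p % 4 = 3) {k : ℕ} (hk : k < p) {x : ℚ}
    (hx : x ∈ pMultiples p 2) (hx' : 2 * p ≤ 3 * k → x ∈ pMultiples p 3) :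
    x / (4 * k + 1) ∈ pMultiples p 2 := by
  by_cases hd : (p : ℤ) ∣ 4 * k + 1
  · obtain ⟨c, hc⟩ := hd
    have hc0 : 0 < c := by
      by_contra! hneg
      nlinarith
    have hc4 : c < 4 := by
      by_contra! hge
      nlinarith
    obtain rfl : c = 3 := by interval_cases c <;> omega
    obtain ⟨y, hy, rfl⟩ := mem_pMultiples.mp (hx' (by omega))
    have h3 : ¬ (p : ℤ) ∣ 3 := fun h =>
      absurd (Nat.le_of_dvd (by norm_num) (by exact_mod_cast h : p ∣ 3)) (by omega)
    refine mem_pMultiples.mpr ⟨y * ((3 : ℤ) : ℚ)⁻¹, mul_mem hy (int_inv_mem_integer h3), ?_⟩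
    have hq : (4 * k + 1 : ℚ) = p * 3 := by exact_mod_cast hc
    have hp0 : (p : ℚ) ≠ 0 := by positivity
    rw [hq]
    push_cast
    field_simp
  · have h := div_mem_pMultiples hx hd
    exact_mod_cast h

lemma sum_div_mem (hp : 3 < p) (h4 : p % 4 = 3) (L : ℕ → ℚ)
    (hL : ∀ k < p, L k - p * legendreCoeff (p / 3 : ℕ) k ∈ pMultiples p 2)
    (hL' : ∀ k < p, 2 * p ≤ 3 * k → L k ∈ pMultiples p 3) :
    ∑ k ∈ Finset.range p, L k / (4 * k + 1) ∈ pMultiples p 2 := by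
  have hS := sum_legendreCoeff_mem h4 hp (m := p / 3)
    (lt_of_le_of_ne (Nat.mul_div_le p 3) fun h => by
      have := (Nat.prime_dvd_prime_iff_eq Nat.prime_three (Fact.out : p.Prime)).mp ⟨_, h.symm⟩
      omega)
  rw [if_pos (by omega)] at hS
  have hpS := mul_mem_pMultiples (prime_mem_pMultiples_one (p := p)) hS
  have hdiff : ∑ k ∈ Finset.range p, (L k - p * legendreCoeff (p / 3 : ℕ) k) / (4 * k + 1) ∈
      pMultiples p 2 := by
    refine sum_mem fun k hk => ?_
    have hk' := Finset.mem_range.mp hk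
    refine div_succ_mem hp h4 hk' (hL k hk') fun h => ?_
    rw [legendreCoeff_eq_zero (by omega), mul_zero, sub_zero]
    exact hL' k hk' h
  convert add_mem hdiff hpS using 1
  rw [Finset.mul_sum, ← Finset.sum_add_distrib]
  exact Finset.sum_congr rfl fun k _ => by ring

end Integrality

theorem stmt17 (p : ℕ) (hp : p.Prime) (hp3 : 3 < p) (hp4 : p % 4 = 3) :
    pCong p 2 (∑ n ∈ Finset.range p, (az n : ℚ) / (-3) ^ n)
      (∑ n ∈ Finset.range p, (az n : ℚ) / (-27) ^ n) ∧
    pCong p 2 (∑ n ∈ Finset.range p, (az n : ℚ) / (-27) ^ n) 0 := by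
  have : Fact p.Prime := ⟨hp⟩
  have hlow : ∑ n ∈ Finset.range p, (az n : ℚ) / (-3) ^ n ∈ pMultiples p 2 := by
    rw [sum_az_div_neg_three]
    refine sum_div_mem hp3 hp4 _ (fun k hk => lowProd_congr hp3 hk) fun k hk h => ?_
    rw [lowProd_eq_zero (by omega), zero_mul, mul_zero]
    exact zero_mem _
  have hhigh : ∑ n ∈ Finset.range p, (az n : ℚ) / (-27) ^ n ∈ pMultiples p 2 := by
    rw [sum_az_div_neg_twentySeven]
    refine sum_div_mem hp3 hp4 _ (fun k hk => highProd_congr hp3 hk) fun k hk h => ?_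
    have hq : 2 ≤ 3 * k / p := (Nat.le_div_iff_mul_le hp.pos).mpr h
    exact pMultiples_anti (by omega) (highProd_mem hp3 hk)
  refine ⟨pCong_iff.mpr (sub_mem hlow hhigh), pCong_iff.mpr ?_⟩
  rwa [sub_zero]
end

section
/- Let p be a prime with p ≡ 1 (mod 4), and let b_n = Σ_{k=0}^{⌊n/3⌋} C(2k,k)·C(3k,k)·C(n,3k)·C(n+k,k)·(−3)^{n−3k} denote the Almkvist–Zudilin numbers. If p ≡ 1 (mod 12) and x, y are integers with p = x² + 9y², then Σ_{n=0}^{p−1} b_n/(−3)^n ≡ Σ_{n=0}^{p−1} b_n/(−27)^n ≡ 4x² − 2p (mod p²). If p ≡ 5 (mod 12) and x, y are integers with 2p = x² + 9y², then Σ_{n=0}^{p−1} b_n/(−3)^n ≡ Σ_{n=0}^{p−1} b_n/(−27)^n ≡ 2p − 2x² (mod p²). -/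
section Preliminaries

open Finset

/-- The reciprocal of the factorial, extended by zero to negative integers. -/
def invFact (z : ℤ) : ℚ := if 0 ≤ z then 1 / (z.toNat.factorial : ℚ) else 0

lemma invFact_eq_mul (z : ℤ) : invFact z = (z + 1) * invFact (z + 1) := by
  unfold invFact
  rcases lt_trichotomy z (-1) with h | h | h
  · simp [show ¬ 0 ≤ z by omega, show ¬ 0 ≤ z + 1 by omega]
  · subst h; simp
  · lift z to ℕ using by omega
    have h1 : ((z : ℤ) + 1).toNat = z + 1 := by omega
    have h2 : (z.factorial : ℚ) ≠ 0 := by exact_mod_cast z.factorial_ne_zero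
    have h3 : (z : ℚ) + 1 ≠ 0 := by positivity
    simp only [h1, Int.toNat_natCast, Nat.factorial_succ]
    rw [if_pos (by omega), if_pos (by omega)]
    push_cast
    field_simp

lemma invFact_natCast (d : ℕ) : invFact d = 1 / (d.factorial : ℚ) := by simp [invFact]

lemma invFact_of_neg {z : ℤ} (h : z < 0) : invFact z = 0 := by
  simp [invFact, not_le.mpr h]

/-- Summand of the expansion of the Almkvist–Zudilin numbers in powers of `-3`. -/
def azTerm (n k : ℕ) : ℚ :=
  ((n + k).factorial : ℚ) * invFact (n - 3 * k) / (k.factorial : ℚ) ^ 4 *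
    (-3 : ℚ) ^ ((n : ℤ) - 3 * k)

/-- Summand of the expansion of the Almkvist–Zudilin numbers in powers of `-27`. -/
def azTerm' (n k : ℕ) : ℚ :=
  ((n + 3 * k).factorial : ℚ) * invFact (n - k) / (k.factorial : ℚ) ^ 4 *
    (-27 : ℚ) ^ ((n : ℤ) - k)

lemma azTerm_recurrence (n k : ℕ) :
    ((n : ℚ) + 2) ^ 3 * azTerm (n + 2) k +
      (2 * n + 3) * (7 * n ^ 2 + 21 * n + 17) * azTerm (n + 1) k +
      81 * (n + 1) ^ 3 * azTerm n k =
    azTerm n k * (n + k + 1) * (n - 3 * k) * (12 * (4 * n + 5)) -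
      (if k = 0 then 0 else
        azTerm n (k - 1) * (n + k) * (n - 3 * k + 3) * (12 * (4 * n + 5))) := by
  have hz : (-3 : ℚ) ≠ 0 := by norm_num
  have s0 := invFact_eq_mul ((n : ℤ) - 3 * k)
  have s1 := invFact_eq_mul ((n : ℤ) - 3 * k + 1)
  have s2 := invFact_eq_mul ((n : ℤ) - 3 * k + 1 + 1)
  have hk : (k.factorial : ℚ) ≠ 0 := by exact_mod_cast k.factorial_ne_zero
  have e1 : azTerm (n + 1) k = ((n : ℚ) + k + 1) * (n + k).factorial *
      invFact ((n : ℤ) - 3 * k + 1) / (k.factorial : ℚ) ^ 4 *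
        ((-3 : ℚ) ^ ((n : ℤ) - 3 * k) * (-3)) := by
    unfold azTerm
    rw [show n + 1 + k = (n + k) + 1 by ring, Nat.factorial_succ, ← zpow_add_one₀ hz]
    push_cast
    rw [show (n : ℤ) + 1 - 3 * k = n - 3 * k + 1 by ring]
  have e2 : azTerm (n + 2) k = ((n : ℚ) + k + 2) * ((n : ℚ) + k + 1) * (n + k).factorial *
      invFact ((n : ℤ) - 3 * k + 1 + 1) / (k.factorial : ℚ) ^ 4 *
        ((-3 : ℚ) ^ ((n : ℤ) - 3 * k) * 9) := by
    unfold azTerm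
    rw [show n + 2 + k = (n + k) + 1 + 1 by ring, Nat.factorial_succ, Nat.factorial_succ]
    push_cast
    rw [show (n : ℤ) + 2 - 3 * k = n - 3 * k + 1 + 1 by ring, zpow_add_one₀ hz,
      zpow_add_one₀ hz]
    ring
  rcases k with _ | j
  · simp only [if_true]
    rw [e1, e2]
    unfold azTerm
    rw [s0, s1]
    push_cast
    field_simp
    ring
  · have e3 : azTerm n j = ((n + (j + 1)).factorial : ℚ) / (n + j + 1) *
        invFact ((n : ℤ) - 3 * (j + 1 : ℕ) + 1 + 1 + 1) /
        ((j + 1).factorial : ℚ) ^ 4 * (j + 1) ^ 4 *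
        ((-3 : ℚ) ^ ((n : ℤ) - 3 * (j + 1 : ℕ)) * (-27)) := by
      unfold azTerm
      rw [show n + (j + 1) = (n + j) + 1 by ring, Nat.factorial_succ, Nat.factorial_succ]
      have h1 : (n : ℤ) - 3 * j = n - 3 * (j + 1 : ℕ) + 1 + 1 + 1 := by push_cast; ring
      have h2 : (-3 : ℚ) ^ ((n : ℤ) - 3 * j) = (-3 : ℚ) ^ ((n : ℤ) - 3 * (j + 1 : ℕ)) * (-27) := by
        rw [h1, zpow_add_one₀ hz, zpow_add_one₀ hz, zpow_add_one₀ hz]; ring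
      rw [h2, h1]
      have h3 : (n : ℚ) + j + 1 ≠ 0 := by positivity
      have h4 : (j : ℚ) + 1 ≠ 0 := by positivity
      have h5 : (j.factorial : ℚ) ≠ 0 := by exact_mod_cast j.factorial_ne_zero
      push_cast
      field_simp
    rw [if_neg (by omega), e1, e2, show j + 1 - 1 = j from rfl, e3]
    unfold azTerm
    rw [s0, s1, s2]
    have h3 : (n : ℚ) + j + 1 ≠ 0 := by positivity
    push_cast at hk ⊢
    field_simp
    ring

lemma azTerm'_recurrence (n k : ℕ) :
    ((n : ℚ) + 2) ^ 3 * azTerm' (n + 2) k +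
      (2 * n + 3) * (7 * n ^ 2 + 21 * n + 17) * azTerm' (n + 1) k +
      81 * (n + 1) ^ 3 * azTerm' n k =
    azTerm' (n + 1) k * (n + 3 * k + 2) * (n + 3 * k + 3) * (-4 * (4 * n + 7)) -
      (if k = 0 then 0 else
        azTerm' (n + 1) (k - 1) * (n + 3 * k - 1) * (n + 3 * k) * (-4 * (4 * n + 7))) := by
  have hz : (-27 : ℚ) ≠ 0 := by norm_num
  have s0 := invFact_eq_mul ((n : ℤ) - k)
  have s1 := invFact_eq_mul ((n : ℤ) - k + 1)
  have hk : (k.factorial : ℚ) ≠ 0 := by exact_mod_cast k.factorial_ne_zero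
  have e1 : azTerm' (n + 1) k = ((n : ℚ) + 3 * k + 1) * (n + 3 * k).factorial *
      invFact ((n : ℤ) - k + 1) / (k.factorial : ℚ) ^ 4 *
        ((-27 : ℚ) ^ ((n : ℤ) - k) * (-27)) := by
    unfold azTerm'
    rw [show n + 1 + 3 * k = (n + 3 * k) + 1 by ring, Nat.factorial_succ, ← zpow_add_one₀ hz]
    push_cast
    rw [show (n : ℤ) + 1 - k = n - k + 1 by ring]
  have e2 : azTerm' (n + 2) k = ((n : ℚ) + 3 * k + 2) * ((n : ℚ) + 3 * k + 1) *
      (n + 3 * k).factorial *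
      invFact ((n : ℤ) - k + 1 + 1) / (k.factorial : ℚ) ^ 4 *
        ((-27 : ℚ) ^ ((n : ℤ) - k) * 729) := by
    unfold azTerm'
    rw [show n + 2 + 3 * k = (n + 3 * k) + 1 + 1 by ring, Nat.factorial_succ, Nat.factorial_succ]
    push_cast
    rw [show (n : ℤ) + 2 - k = n - k + 1 + 1 by ring, zpow_add_one₀ hz,
      zpow_add_one₀ hz]
    ring
  rcases k with _ | j
  · simp only [if_true]
    rw [e1, e2]
    unfold azTerm'
    rw [s0, s1]
    push_cast
    field_simp
    ring
  · have e3 : azTerm' (n + 1) j =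
        ((n + 3 * (j + 1)).factorial : ℚ) / ((n + 3 * j + 3) * (n + 3 * j + 2)) *
        invFact ((n : ℤ) - (j + 1 : ℕ) + 1 + 1) /
        ((j + 1).factorial : ℚ) ^ 4 * (j + 1) ^ 4 *
        ((-27 : ℚ) ^ ((n : ℤ) - (j + 1 : ℕ)) * 729) := by
      unfold azTerm'
      rw [show n + 3 * (j + 1) = (n + 1 + 3 * j) + 1 + 1 by ring, Nat.factorial_succ (_ + 1),
        Nat.factorial_succ (n + 1 + 3 * j), Nat.factorial_succ j]
      have h1 : ((n + 1 : ℕ) : ℤ) - j = n - (j + 1 : ℕ) + 1 + 1 := by push_cast; ring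
      have h2 : (-27 : ℚ) ^ (((n + 1 : ℕ) : ℤ) - j) =
          (-27 : ℚ) ^ ((n : ℤ) - (j + 1 : ℕ)) * 729 := by
        rw [h1, zpow_add_one₀ hz, zpow_add_one₀ hz]; ring
      rw [h2, h1]
      have h3 : (n : ℚ) + 3 * j + 3 ≠ 0 := by positivity
      have h6 : (n : ℚ) + 3 * j + 2 ≠ 0 := by positivity
      have h4 : (j : ℚ) + 1 ≠ 0 := by positivity
      have h5 : (j.factorial : ℚ) ≠ 0 := by exact_mod_cast j.factorial_ne_zero
      push_cast
      field_simp
      ring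
    rw [if_neg (by omega), e1, e2, show j + 1 - 1 = j from rfl, e3]
    unfold azTerm'
    rw [s0, s1]
    have h3 : (n : ℚ) + 3 * j + 3 ≠ 0 := by positivity
    have h6 : (n : ℚ) + 3 * j + 2 ≠ 0 := by positivity
    push_cast at hk ⊢
    field_simp
    ring

lemma azTerm_eq_zero {n k : ℕ} (h : n < k) : azTerm n k = 0 := by
  simp [azTerm, invFact_of_neg (show (n : ℤ) - 3 * k < 0 by omega)]

lemma azTerm'_eq_zero {n k : ℕ} (h : n < k) : azTerm' n k = 0 := by
  simp [azTerm', invFact_of_neg (show (n : ℤ) - k < 0 by omega)]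

lemma sum_azTerm_recurrence (n N : ℕ) (hN : n + 2 < N) :
    ((n : ℚ) + 2) ^ 3 * ∑ k ∈ range N, azTerm (n + 2) k +
      (2 * n + 3) * (7 * n ^ 2 + 21 * n + 17) * ∑ k ∈ range N, azTerm (n + 1) k +
      81 * (n + 1) ^ 3 * ∑ k ∈ range N, azTerm n k = 0 := by
  have h : ∀ M : ℕ, ((n : ℚ) + 2) ^ 3 * ∑ k ∈ range (M + 1), azTerm (n + 2) k +
      (2 * n + 3) * (7 * n ^ 2 + 21 * n + 17) * ∑ k ∈ range (M + 1), azTerm (n + 1) k +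
      81 * (n + 1) ^ 3 * ∑ k ∈ range (M + 1), azTerm n k =
      azTerm n M * (n + M + 1) * (n - 3 * M) * (12 * (4 * n + 5)) := by
    intro M
    induction M with
    | zero => simpa using azTerm_recurrence n 0
    | succ M ih =>
      have := azTerm_recurrence n (M + 1)
      rw [if_neg (by omega), show M + 1 - 1 = M from rfl] at this
      simp only [sum_range_succ _ (M + 1)]
      push_cast at this ⊢
      linear_combination ih + this
  obtain ⟨M, rfl⟩ : ∃ M, N = M + 1 := ⟨N - 1, by omega⟩
  rw [h, azTerm_eq_zero (by omega)]
  ring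

lemma sum_azTerm'_recurrence (n N : ℕ) (hN : n + 2 < N) :
    ((n : ℚ) + 2) ^ 3 * ∑ k ∈ range N, azTerm' (n + 2) k +
      (2 * n + 3) * (7 * n ^ 2 + 21 * n + 17) * ∑ k ∈ range N, azTerm' (n + 1) k +
      81 * (n + 1) ^ 3 * ∑ k ∈ range N, azTerm' n k = 0 := by
  have h : ∀ M : ℕ, ((n : ℚ) + 2) ^ 3 * ∑ k ∈ range (M + 1), azTerm' (n + 2) k +
      (2 * n + 3) * (7 * n ^ 2 + 21 * n + 17) * ∑ k ∈ range (M + 1), azTerm' (n + 1) k +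
      81 * (n + 1) ^ 3 * ∑ k ∈ range (M + 1), azTerm' n k =
      azTerm' (n + 1) M * (n + 3 * M + 2) * (n + 3 * M + 3) * (-4 * (4 * n + 7)) := by
    intro M
    induction M with
    | zero => simpa using azTerm'_recurrence n 0
    | succ M ih =>
      have := azTerm'_recurrence n (M + 1)
      rw [if_neg (by omega), show M + 1 - 1 = M from rfl] at this
      simp only [sum_range_succ _ (M + 1)]
      push_cast at this ⊢
      linear_combination ih + this
  obtain ⟨M, rfl⟩ : ∃ M, N = M + 1 := ⟨N - 1, by omega⟩
  rw [h, azTerm'_eq_zero (by omega)]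
  ring

lemma sum_azTerm_eq_sum_azTerm' (N n : ℕ) (hN : n + 1 < N) :
    ∑ k ∈ range N, azTerm n k = ∑ k ∈ range N, azTerm' n k := by
  induction n using Nat.twoStepInduction with
  | zero =>
    refine sum_congr rfl fun k _ => ?_
    rcases k with _ | k
    · simp [azTerm, azTerm']
    · rw [azTerm_eq_zero (by omega), azTerm'_eq_zero (by omega)]
  | one =>
    obtain ⟨M, rfl⟩ : ∃ M, N = M + 2 := ⟨N - 2, by omega⟩
    rw [sum_range_succ', sum_range_succ', sum_range_succ', sum_range_succ',
      sum_eq_zero (fun k _ => azTerm_eq_zero (by omega)),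
      sum_eq_zero (fun k _ => azTerm'_eq_zero (by omega))]
    have h1 : invFact (-2) = 0 := invFact_of_neg (by norm_num)
    have h2 : invFact 1 = 1 := by simpa using invFact_natCast 1
    have h3 : invFact 0 = 1 := by simpa using invFact_natCast 0
    norm_num [azTerm, azTerm', h1, h2, h3, Nat.factorial]
  | more n ih0 ih1 =>
    have h := sum_azTerm_recurrence n N (by omega)
    have hh := sum_azTerm'_recurrence n N (by omega)
    rw [ih0 (by omega), ih1 (by omega)] at h
    have h2 : ((n : ℚ) + 2) ^ 3 ≠ 0 := by positivity
    exact mul_left_cancel₀ h2 (by linear_combination h - hh)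

/-- The multinomial coefficient `(4k)! / k!^4`. -/
def quadChoose (k : ℕ) : ℕ := (4 * k).choose k * (3 * k).choose k * (2 * k).choose k

lemma quadChoose_mul (k : ℕ) : quadChoose k * k.factorial ^ 4 = (4 * k).factorial := by
  have h1 := Nat.choose_mul_factorial_mul_factorial (show k ≤ 4 * k by omega)
  have h2 := Nat.choose_mul_factorial_mul_factorial (show k ≤ 3 * k by omega)
  have h3 := Nat.choose_mul_factorial_mul_factorial (show k ≤ 2 * k by omega)
  rw [show 4 * k - k = 3 * k by omega] at h1
  rw [show 3 * k - k = 2 * k by omega] at h2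
  rw [show 2 * k - k = k by omega] at h3
  unfold quadChoose
  rw [← h1, ← h2, ← h3]
  ring

lemma azTerm_eq (n k : ℕ) :
    azTerm n k = (quadChoose k * (n + k).choose (4 * k) * (-3 : ℤ) ^ (n - 3 * k) : ℤ) := by
  by_cases h : 3 * k ≤ n
  · obtain ⟨d, rfl⟩ := Nat.exists_eq_add_of_le h
    have h1 := Nat.choose_mul_factorial_mul_factorial (show 4 * k ≤ 3 * k + d + k by omega)
    rw [show 3 * k + d + k - 4 * k = d by omega, ← quadChoose_mul] at h1
    have hd : (d.factorial : ℚ) ≠ 0 := by exact_mod_cast d.factorial_ne_zero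
    have hk : (k.factorial : ℚ) ≠ 0 := by exact_mod_cast k.factorial_ne_zero
    unfold azTerm
    rw [show ((3 * k + d : ℕ) : ℤ) - 3 * k = d by push_cast; ring, invFact_natCast, ← h1,
      show 3 * k + d - 3 * k = d by omega, zpow_natCast]
    push_cast
    field_simp
  · unfold azTerm
    rw [invFact_of_neg (by omega), Nat.choose_eq_zero_of_lt (show n + k < 4 * k by omega)]
    simp

lemma azTerm'_eq (n k : ℕ) :
    azTerm' n k = (quadChoose k * (n + 3 * k).choose (4 * k) * (-27 : ℤ) ^ (n - k) : ℤ) := by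
  by_cases h : k ≤ n
  · obtain ⟨d, rfl⟩ := Nat.exists_eq_add_of_le h
    have h1 := Nat.choose_mul_factorial_mul_factorial (show 4 * k ≤ k + d + 3 * k by omega)
    rw [show k + d + 3 * k - 4 * k = d by omega, ← quadChoose_mul] at h1
    have hd : (d.factorial : ℚ) ≠ 0 := by exact_mod_cast d.factorial_ne_zero
    have hk : (k.factorial : ℚ) ≠ 0 := by exact_mod_cast k.factorial_ne_zero
    unfold azTerm'
    rw [show ((k + d : ℕ) : ℤ) - k = d by push_cast; ring, invFact_natCast, ← h1,
      show k + d - k = d by omega, zpow_natCast]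
    push_cast
    field_simp
  · unfold azTerm'
    rw [invFact_of_neg (by omega), Nat.choose_eq_zero_of_lt (show n + 3 * k < 4 * k by omega)]
    simp

lemma az_eq_sum (n N : ℕ) (hN : n < N) :
    az n = ∑ k ∈ range N, (quadChoose k * (n + k).choose (4 * k) * (-3 : ℤ) ^ (n - 3 * k) : ℤ) := by
  unfold az
  have hsub : range (n / 3 + 1) ⊆ range N := range_subset_range.mpr (by omega)
  rw [← sum_subset hsub]
  · refine sum_congr rfl fun k hk => ?_
    rw [mem_range] at hk
    have h1 := Nat.choose_mul (n := n + k) (k := 4 * k) (s := k) (by omega)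
    rw [show n + k - k = n by omega, show 4 * k - k = 3 * k by omega] at h1
    have h2 : ((n + k).choose (4 * k) : ℤ) * (4 * k).choose k =
      (n + k).choose k * n.choose (3 * k) := by exact_mod_cast h1
    unfold quadChoose
    push_cast
    linear_combination -(((3 * k).choose k : ℤ) * (2 * k).choose k * (-3) ^ (n - 3 * k)) * h2
  · intro k _ hk
    rw [mem_range] at hk
    rw [Nat.choose_eq_zero_of_lt (show n + k < 4 * k by omega)]
    simp

lemma az_eq_sum' (n N : ℕ) (hN : n + 1 < N) :
    az n = ∑ k ∈ range N, (quadChoose k * (n + 3 * k).choose (4 * k) * (-27 : ℤ) ^ (n - k) : ℤ) := by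
  have h := sum_azTerm_eq_sum_azTerm' N n hN
  simp only [azTerm_eq, azTerm'_eq] at h
  rw [az_eq_sum n N (by omega)]
  exact_mod_cast h

section Residue

lemma natCast_mul_self_eq_zero {p : ℕ} : (p : ZMod (p ^ 2)) * p = 0 := by
  rw [← Nat.cast_mul, ← sq, ZMod.natCast_self]

variable {p : ℕ} [hp : Fact p.Prime]

/-- Reduction from `ℤ/p²` to `ℤ/p`. -/
def resid (p : ℕ) : ZMod (p ^ 2) →+* ZMod p := ZMod.castHom (dvd_pow_self p two_ne_zero) (ZMod p)

lemma isUnit_of_resid_ne_zero {x : ZMod (p ^ 2)} (h : resid p x ≠ 0) : IsUnit x := by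
  have : NeZero (p ^ 2) := ⟨pow_ne_zero _ hp.out.ne_zero⟩
  rw [← ZMod.natCast_zmod_val x] at h ⊢
  rw [map_natCast, Ne, ZMod.natCast_eq_zero_iff] at h
  rw [ZMod.isUnit_iff_coprime]
  exact Nat.Coprime.pow_right 2 ((hp.out.coprime_iff_not_dvd.mpr h).symm)

lemma exists_of_resid_eq {x y : ZMod (p ^ 2)} (h : resid p x = resid p y) :
    ∃ w, x = y + p * w := by
  have : NeZero (p ^ 2) := ⟨pow_ne_zero _ hp.out.ne_zero⟩
  have h1 : resid p (x - y) = 0 := by rw [map_sub, h, sub_self]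
  rw [← ZMod.natCast_zmod_val (x - y), map_natCast, ZMod.natCast_eq_zero_iff] at h1
  obtain ⟨w, hw⟩ := h1
  refine ⟨w, ?_⟩
  rw [← Nat.cast_mul, ← hw, ZMod.natCast_zmod_val]
  ring

lemma natCast_mul_eq_of_resid_eq {x y : ZMod (p ^ 2)} (h : resid p x = resid p y) :
    (p : ZMod (p ^ 2)) * x = p * y := by
  obtain ⟨w, rfl⟩ := exists_of_resid_eq h
  linear_combination w * natCast_mul_self_eq_zero (p := p)

lemma resid_natCast_val (x : ZMod p) : resid p (x.val : ZMod (p ^ 2)) = x := by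
  have : NeZero p := ⟨hp.out.ne_zero⟩
  rw [map_natCast, ZMod.natCast_zmod_val]

/-- The isomorphism from `ℤ/p` to the units of `ℤ/p²` congruent to `1` modulo `p`. -/
def oneUnit (x : ZMod p) : ZMod (p ^ 2) := 1 + p * (x.val : ZMod (p ^ 2))

lemma oneUnit_resid (x : ZMod (p ^ 2)) : oneUnit (resid p x) = 1 + p * x := by
  unfold oneUnit
  rw [natCast_mul_eq_of_resid_eq (resid_natCast_val _)]

lemma oneUnit_add (x y : ZMod p) : oneUnit (x + y) = oneUnit x * oneUnit y := by
  rw [← resid_natCast_val x, ← resid_natCast_val y, ← map_add]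
  simp only [oneUnit_resid]
  linear_combination -((x.val : ZMod (p ^ 2)) * y.val) * natCast_mul_self_eq_zero (p := p)

lemma oneUnit_zero : oneUnit (0 : ZMod p) = 1 := by simp [oneUnit]

lemma oneUnit_sum {ι : Type*} (s : Finset ι) (f : ι → ZMod p) :
    oneUnit (∑ i ∈ s, f i) = ∏ i ∈ s, oneUnit (f i) := by
  classical
  induction s using Finset.induction_on with
  | empty => simp [oneUnit_zero]
  | insert a s ha ih => rw [sum_insert ha, prod_insert ha, oneUnit_add, ih]

lemma oneUnit_natCast_mul (k : ℕ) (x : ZMod p) : oneUnit ((k : ZMod p) * x) = oneUnit x ^ k := by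
  induction k with
  | zero => simp [oneUnit_zero]
  | succ k ih => rw [Nat.cast_succ, add_mul, oneUnit_add, ih, one_mul, pow_succ (oneUnit x)]

lemma add_natCast_mul {a : ZMod (p ^ 2)} (b : ZMod (p ^ 2)) (h : resid p a ≠ 0) :
    a + (p : ZMod (p ^ 2)) * b = a * oneUnit (resid p b / resid p a) := by
  have h1 : (p : ZMod (p ^ 2)) * (a * ((resid p b / resid p a).val : ZMod (p ^ 2))) = p * b := by
    refine natCast_mul_eq_of_resid_eq ?_
    rw [map_mul, resid_natCast_val, mul_div_cancel₀ _ h]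
  unfold oneUnit
  linear_combination -h1

lemma prod_add_natCast_mul {ι : Type*} (s : Finset ι) (a : ι → ZMod (p ^ 2)) (b : ZMod (p ^ 2))
    (h : ∀ i ∈ s, resid p (a i) ≠ 0) :
    ∏ i ∈ s, (a i + (p : ZMod (p ^ 2)) * b) =
      (∏ i ∈ s, a i) * oneUnit (∑ i ∈ s, resid p b / resid p (a i)) := by
  rw [oneUnit_sum, ← prod_mul_distrib]
  exact prod_congr rfl fun i hi => add_natCast_mul b (h i hi)

lemma natCast_zmod_ne_zero {k : ℕ} (h0 : k ≠ 0) (h : k < p) : (k : ZMod p) ≠ 0 := by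
  rw [Ne, ZMod.natCast_eq_zero_iff]
  exact Nat.not_dvd_of_pos_of_lt (Nat.pos_of_ne_zero h0) h

lemma isUnit_natCast {k : ℕ} (h0 : k ≠ 0) (h : k < p) : IsUnit (k : ZMod (p ^ 2)) :=
  isUnit_of_resid_ne_zero (by rw [map_natCast]; exact natCast_zmod_ne_zero h0 h)

lemma factorial_zmod_ne_zero {k : ℕ} (h : k < p) : (k.factorial : ZMod p) ≠ 0 := by
  rw [Ne, ZMod.natCast_eq_zero_iff, hp.out.dvd_factorial]
  omega

lemma isUnit_factorial {k : ℕ} (h : k < p) : IsUnit (k.factorial : ZMod (p ^ 2)) :=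
  isUnit_of_resid_ne_zero (by rw [map_natCast]; exact factorial_zmod_ne_zero h)

end Residue

/-- The coefficients of the shifted Legendre polynomial of degree `n`. -/
def legCoeff (n k : ℕ) : ℤ := (-1) ^ k * n.choose k * (n + k).choose k

lemma legCoeff_eq_zero {n k : ℕ} (h : n < k) : legCoeff n k = 0 := by
  simp [legCoeff, Nat.choose_eq_zero_of_lt h]

lemma legCoeff_succ (n k : ℕ) :
    ((k : ℤ) + 1) ^ 2 * legCoeff n (k + 1) = (n + k + 1) * (k - n) * legCoeff n k := by
  have h1 : (n.choose (k + 1) : ℤ) * (k + 1) = n.choose k * (n - k) := by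
    rcases le_or_gt k n with h | h
    · have := Nat.choose_succ_right_eq n k
      zify [h] at this
      exact this
    · simp [Nat.choose_eq_zero_of_lt h, Nat.choose_eq_zero_of_lt (show n < k + 1 by omega)]
  have h2 : ((n + (k + 1)).choose (k + 1) : ℤ) * (k + 1) = (n + k + 1) * (n + k).choose k := by
    have := Nat.add_one_mul_choose_eq (n + k) k
    rw [← add_assoc]
    exact_mod_cast this.symm
  unfold legCoeff
  rw [pow_succ]
  linear_combination (-1) ^ k * (-1) * ((n + (k + 1)).choose (k + 1) : ℤ) * (k + 1) * h1 -
    (-1) ^ k * (n.choose k : ℤ) * (n - k) * h2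

lemma legCoeff_mul_prod (n j : ℕ) (hj : j ≤ n) :
    legCoeff n j * ∏ i ∈ (range (n + 1)).erase j, ((i : ℤ) - j) =
      ∏ i ∈ range n, ((i : ℤ) + 1 + j) := by
  obtain ⟨l, rfl⟩ := Nat.exists_eq_add_of_le hj
  have h1 : ∏ i ∈ (range (j + l + 1)).erase j, ((i : ℤ) - j) =
      (-1) ^ j * j.factorial * l.factorial := by
    have hs : (range (j + l + 1)).erase j = range j ∪ Ico (j + 1) (j + l + 1) := by
      ext i; simp only [mem_erase, mem_range, mem_union, mem_Ico]; omega
    have hd : Disjoint (range j) (Ico (j + 1) (j + l + 1)) := by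
      rw [disjoint_left]; intro i; simp only [mem_range, mem_Ico]; omega
    rw [hs, prod_union hd, prod_Ico_eq_prod_range, ← prod_range_reflect,
      show j + l + 1 - (j + 1) = l by omega, ← prod_range_add_one_eq_factorial,
      ← prod_range_add_one_eq_factorial]
    push_cast
    congr 1
    · rw [← card_range j, ← prod_const, card_range, ← prod_mul_distrib]
      refine prod_congr rfl fun i hi => ?_
      rw [mem_range] at hi
      rw [Nat.cast_sub (by omega), Nat.cast_sub (by omega)]
      push_cast
      ring
    · exact prod_congr rfl fun i _ => by ring
  have h2 : (j.factorial : ℤ) * ∏ i ∈ range (j + l), ((i : ℤ) + 1 + j) =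
      (j + l + j).factorial := by
    have := Nat.factorial_mul_ascFactorial j (j + l)
    rw [Nat.ascFactorial_eq_prod_range] at this
    rw [show j + l + j = j + (j + l) by ring, ← this]
    push_cast
    congr 1
    exact prod_congr rfl fun i _ => by ring
  have h3 := Nat.choose_mul_factorial_mul_factorial (show j ≤ j + l by omega)
  have h4 := Nat.choose_mul_factorial_mul_factorial (show j ≤ j + l + j by omega)
  rw [show j + l - j = l by omega] at h3
  rw [show j + l + j - j = j + l by omega] at h4
  zify at h3 h4
  have hne : (j.factorial : ℤ) ≠ 0 := by exact_mod_cast j.factorial_ne_zero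
  refine mul_left_cancel₀ hne ?_
  rw [h1, h2, ← h4, ← h3]
  unfold legCoeff
  have hs : ((-1 : ℤ) ^ j) * (-1) ^ j = 1 := by rw [← mul_pow]; simp
  linear_combination ((j.factorial : ℤ) * (j + l).choose j * (j + l + j).choose j *
    j.factorial * l.factorial) * hs

open Polynomial in
lemma sum_legCoeff_mul_prod_polynomial (n : ℕ) :
    ∑ k ∈ range (n + 1), C (legCoeff n k) * ∏ i ∈ (range (n + 1)).erase k, (X + C (i : ℤ)) =
      ∏ i ∈ range n, (C ((i : ℤ) + 1) - X) := by
  classical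
  have hinj : Set.InjOn (fun k : ℕ => -(k : ℤ)) (range (n + 1)) := by
    intro a _ b _ h
    simpa using h
  refine eq_of_degrees_lt_of_eval_finset_eq ((range (n + 1)).image fun k : ℕ => -(k : ℤ)) ?_ ?_ ?_
  · rw [card_image_of_injOn hinj, card_range]
    refine lt_of_le_of_lt (degree_sum_le _ _) ?_
    rw [Finset.sup_lt_iff (by exact WithBot.bot_lt_coe _)]
    intro k hk
    refine lt_of_le_of_lt (degree_mul_le _ _) ?_
    have h1 : (∏ i ∈ (range (n + 1)).erase k, (X + C (i : ℤ))).degree = (n : WithBot ℕ) := by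
      rw [degree_prod]
      simp only [degree_X_add_C, sum_const, card_erase_of_mem hk, card_range]
      simp
    rw [h1]
    have h2 : (C (legCoeff n k)).degree ≤ 0 := degree_C_le
    calc (C (legCoeff n k)).degree + (n : WithBot ℕ) ≤ 0 + n := by gcongr
      _ < ((n + 1 : ℕ) : WithBot ℕ) := by rw [zero_add]; exact_mod_cast Nat.lt_succ_self n
  · rw [card_image_of_injOn hinj, card_range, degree_prod]
    have : ∀ i ∈ range n, (C ((i : ℤ) + 1) - X : ℤ[X]).degree = 1 := fun i _ => by
      rw [← neg_sub, degree_neg, degree_X_sub_C]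
    rw [sum_congr rfl this]
    simp only [sum_const, card_range, nsmul_eq_mul, mul_one]
    exact_mod_cast Nat.lt_succ_self n
  · intro x hx
    obtain ⟨j, hj, rfl⟩ := mem_image.mp hx
    rw [mem_range] at hj
    rw [eval_finsetSum, eval_prod, sum_eq_single_of_mem j (mem_range.mpr hj)]
    · rw [eval_mul, eval_prod, eval_C]
      simp only [eval_add, eval_X, eval_C, eval_sub]
      convert legCoeff_mul_prod n j (by omega) using 2
      · exact prod_congr rfl fun i _ => by ring
      · ring
    · intro k _ hkj
      rw [eval_mul, eval_prod, prod_eq_zero (mem_erase.mpr ⟨hkj.symm, mem_range.mpr hj⟩), mul_zero]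
      simp

lemma sum_legCoeff_mul_prod {A : Type*} [CommRing A] (n : ℕ) (z : A) :
    ∑ k ∈ range (n + 1), (legCoeff n k : A) * ∏ i ∈ (range (n + 1)).erase k, (z + i) =
      ∏ i ∈ range n, ((i : A) + 1 - z) := by
  have := congrArg (Polynomial.eval₂ (Int.castRingHom A) z) (sum_legCoeff_mul_prod_polynomial n)
  have hC : ∀ a : ℤ, Polynomial.eval₂ (Int.castRingHom A) z (Polynomial.C a) = a := fun a => by
    rw [Polynomial.eval₂_C]; rfl
  simp only [Polynomial.eval₂_finsetSum, Polynomial.eval₂_finsetProd, Polynomial.eval₂_mul,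
    Polynomial.eval₂_add, Polynomial.eval₂_sub, Polynomial.eval₂_X, hC] at this
  simpa using this

/-- The coefficients `C(3k,k) C(2k,k)`. -/
def tripChoose (k : ℕ) : ℕ := (3 * k).choose k * (2 * k).choose k

lemma tripChoose_mul (k : ℕ) : tripChoose k * k.factorial ^ 3 = (3 * k).factorial := by
  have h1 := Nat.choose_mul_factorial_mul_factorial (show k ≤ 3 * k by omega)
  have h2 := Nat.choose_mul_factorial_mul_factorial (show k ≤ 2 * k by omega)
  rw [show 3 * k - k = 2 * k by omega, ← h2, show 2 * k - k = k by omega] at h1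
  rw [← h1, tripChoose]
  ring

lemma sum_range_choose_add {a b : ℕ} (h : a ≤ b) (N : ℕ) :
    ∑ n ∈ range N, (n + a).choose b = (N + a).choose (b + 1) := by
  induction N with
  | zero => simp [Nat.choose_eq_zero_of_lt (show a < b + 1 by omega)]
  | succ N ih => rw [sum_range_succ, ih, add_right_comm, Nat.choose_succ_succ, add_comm]

lemma cast_descFactorial_add (N a b : ℕ) (h : b ≤ N) :
    ((N + a).descFactorial (a + 1 + b) : ℤ) =
      N * ((∏ j ∈ range a, ((N : ℤ) + (j + 1))) * ∏ j ∈ range b, ((N : ℤ) - (j + 1))) := by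
  rw [Nat.descFactorial_eq_prod_range, prod_range_add, prod_range_succ]
  push_cast
  rw [← prod_range_reflect]
  have h1 : ∏ j ∈ range a, ((N + a - (a - 1 - j) : ℕ) : ℤ) = ∏ j ∈ range a, ((N : ℤ) + (j + 1)) := by
    refine prod_congr rfl fun j hj => ?_
    rw [mem_range] at hj
    rw [show N + a - (a - 1 - j) = N + (j + 1) by omega]
    push_cast
    ring
  have h2 : ∏ j ∈ range b, ((N + a - (a + 1 + j) : ℕ) : ℤ) = ∏ j ∈ range b, ((N : ℤ) - (j + 1)) := by
    refine prod_congr rfl fun j hj => ?_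
    rw [mem_range] at hj
    rw [show N + a - (a + 1 + j) = N - (j + 1) by omega, Nat.cast_sub (by omega)]
    push_cast
    ring
  rw [h1, h2, show N + a - a = N by omega]
  ring

lemma quadChoose_mul_choose (k M : ℕ) :
    (4 * k + 1) * k.factorial ^ 4 * (quadChoose k * M.choose (4 * k + 1)) =
      M.descFactorial (4 * k + 1) := by
  rw [Nat.descFactorial_eq_factorial_mul_choose, Nat.factorial_succ, ← quadChoose_mul]
  ring

lemma cast_descFactorial_eq_zero_of_lt {N a b : ℕ} (h : N < b) :
    (N : ℤ) * ((∏ j ∈ range a, ((N : ℤ) + (j + 1))) * ∏ j ∈ range b, ((N : ℤ) - (j + 1))) = 0 := by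
  rcases Nat.eq_zero_or_pos N with h0 | h0
  · simp [h0]
  · rw [prod_eq_zero (i := N - 1) (s := range b) (mem_range.mpr (by omega)) (by
      rw [Nat.cast_sub (by omega)]; push_cast; ring)]
    simp

lemma cast_descFactorial_add' (N a b : ℕ) :
    ((N + a).descFactorial (a + 1 + b) : ℤ) =
      N * ((∏ j ∈ range a, ((N : ℤ) + (j + 1))) * ∏ j ∈ range b, ((N : ℤ) - (j + 1))) := by
  rcases le_or_gt b N with h | h
  · exact cast_descFactorial_add N a b h
  · rw [cast_descFactorial_eq_zero_of_lt h, Nat.descFactorial_of_lt (by omega), Nat.cast_zero]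

lemma prod_range_neg_succ {A : Type*} [CommRing A] (k : ℕ) :
    ∏ j ∈ range k, (-((j : A) + 1)) = (-1) ^ k * (k.factorial : A) := by
  rw [← prod_range_add_one_eq_factorial, prod_neg, card_range]
  push_cast
  rfl

lemma prod_range_cast_succ {A : Type*} [CommRing A] (k : ℕ) :
    ∏ j ∈ range k, ((j : A) + 1) = (k.factorial : A) := by
  rw [← prod_range_add_one_eq_factorial]
  push_cast
  rfl

section Terms

variable {p : ℕ} [hp : Fact p.Prime]

lemma quadChoose_mul_choose_add {k : ℕ} (hk : k < p) :
    (4 * k + 1) * ((quadChoose k * (p + k).choose (4 * k + 1) : ℕ) : ZMod (p ^ 2)) =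
      p * (-1) ^ k * tripChoose k := by
  have h := cast_descFactorial_add' p k (3 * k)
  rw [show k + 1 + 3 * k = 4 * k + 1 by ring, ← quadChoose_mul_choose] at h
  have h2 := congrArg (Int.cast : ℤ → ZMod (p ^ 2)) h
  have h3 := congrArg (Nat.cast : ℕ → ZMod (p ^ 2)) (tripChoose_mul k)
  push_cast at h2 h3 ⊢
  refine ((isUnit_factorial hk).pow 4).mul_left_cancel ?_
  have h4 : (p : ZMod (p ^ 2)) * ((∏ j ∈ range k, ((p : ZMod (p ^ 2)) + (j + 1))) *
      ∏ j ∈ range (3 * k), ((p : ZMod (p ^ 2)) - (j + 1))) =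
      p * (k.factorial * ((-1) ^ (3 * k) * (3 * k).factorial)) := by
    refine natCast_mul_eq_of_resid_eq ?_
    simp only [map_mul, map_prod, map_add, map_sub, map_natCast, map_one, map_pow, map_neg,
      CharP.cast_eq_zero, zero_add, zero_sub]
    rw [prod_range_neg_succ, prod_range_cast_succ]
  have h5 : ((-1 : ZMod (p ^ 2)) ^ (3 * k)) = (-1) ^ k := by
    rw [pow_mul]; norm_num
  rw [h4, h5, ← h3] at h2
  linear_combination h2

lemma quadChoose_mul_choose_add_three_mul {k : ℕ} (hk : k < p) :
    (4 * k + 1) * ((quadChoose k * (p + 3 * k).choose (4 * k + 1) : ℕ) : ZMod (p ^ 2)) =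
      p * (-1) ^ k * tripChoose k := by
  have h := cast_descFactorial_add' p (3 * k) k
  rw [show 3 * k + 1 + k = 4 * k + 1 by ring, ← quadChoose_mul_choose] at h
  have h2 := congrArg (Int.cast : ℤ → ZMod (p ^ 2)) h
  have h3 := congrArg (Nat.cast : ℕ → ZMod (p ^ 2)) (tripChoose_mul k)
  push_cast at h2 h3 ⊢
  refine ((isUnit_factorial hk).pow 4).mul_left_cancel ?_
  have h4 : (p : ZMod (p ^ 2)) * ((∏ j ∈ range (3 * k), ((p : ZMod (p ^ 2)) + (j + 1))) *
      ∏ j ∈ range k, ((p : ZMod (p ^ 2)) - (j + 1))) =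
      p * ((3 * k).factorial * ((-1) ^ k * k.factorial)) := by
    refine natCast_mul_eq_of_resid_eq ?_
    simp only [map_mul, map_prod, map_add, map_sub, map_natCast, map_one, map_pow, map_neg,
      CharP.cast_eq_zero, zero_add, zero_sub]
    rw [prod_range_neg_succ, prod_range_cast_succ]
  rw [h4, ← h3] at h2
  linear_combination h2

omit hp in
lemma prod_add_mul_prod_sub (k : ℕ) :
    (∏ j ∈ range k, ((p : ZMod (p ^ 2)) + (j + 1))) * ∏ j ∈ range k, ((p : ZMod (p ^ 2)) - (j + 1))
      = (-1) ^ k * (k.factorial : ZMod (p ^ 2)) ^ 2 := by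
  rw [← prod_mul_distrib, ← prod_range_cast_succ, ← prod_pow, ← card_range k, ← prod_const,
    card_range, ← prod_mul_distrib]
  refine prod_congr rfl fun j _ => ?_
  linear_combination natCast_mul_self_eq_zero (p := p)

omit hp in
lemma prod_sub_add (m : ℕ) (hm : p = 4 * m + 1) :
    ∏ j ∈ range (2 * m), ((p : ZMod (p ^ 2)) - ((m + j : ℕ) + 1)) =
      ∏ j ∈ range (2 * m), (((m + j : ℕ) : ZMod (p ^ 2)) + 1) := by
  rw [← prod_range_reflect]
  refine prod_congr rfl fun j hj => ?_
  rw [mem_range] at hj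
  have h : ((p : ℕ) : ZMod (p ^ 2)) =
      ((m + (2 * m - 1 - j) + 1 : ℕ) : ZMod (p ^ 2)) + ((m + j + 1 : ℕ) : ZMod (p ^ 2)) := by
    rw [← Nat.cast_add]; congr 1; omega
  rw [h]
  push_cast
  ring

omit hp in
lemma factorial_mul_prod_range (m : ℕ) :
    (m.factorial : ZMod (p ^ 2)) * ∏ j ∈ range (2 * m), (((m + j : ℕ) : ZMod (p ^ 2)) + 1) =
      ((3 * m).factorial : ZMod (p ^ 2)) := by
  rw [← prod_range_cast_succ, ← prod_range_cast_succ, show 3 * m = m + 2 * m by ring,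
    prod_range_add]

lemma prod_add_add (m : ℕ) (hm : p = 4 * m + 1) :
    ∏ j ∈ range (2 * m), ((p : ZMod (p ^ 2)) + ((m + j : ℕ) + 1)) =
      ∏ j ∈ range (2 * m), (((m + j : ℕ) : ZMod (p ^ 2)) + 1) := by
  have h1 : IsUnit (∏ j ∈ range (2 * m), (((m + j : ℕ) : ZMod (p ^ 2)) + 1)) := by
    have := isUnit_factorial (p := p) (k := 3 * m) (by omega)
    rw [← factorial_mul_prod_range] at this
    exact isUnit_of_mul_isUnit_right this
  refine h1.mul_right_cancel ?_
  nth_rewrite 1 [← prod_sub_add m hm]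
  rw [← prod_mul_distrib, ← prod_mul_distrib]
  have h2 : ∀ j ∈ range (2 * m), ((p : ZMod (p ^ 2)) + ((m + j : ℕ) + 1)) *
      ((p : ZMod (p ^ 2)) - ((m + j : ℕ) + 1)) =
      (-1) * (((((m + j : ℕ) : ZMod (p ^ 2)) + 1)) * (((m + j : ℕ) : ZMod (p ^ 2)) + 1)) := by
    intro j _
    linear_combination natCast_mul_self_eq_zero (p := p)
  rw [prod_congr rfl h2, prod_mul_distrib, prod_const, card_range, pow_mul]
  norm_num

lemma quadChoose_mul_choose_add_self {m : ℕ} (hm : p = 4 * m + 1) :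
    ((quadChoose m * (p + m).choose (4 * m + 1) : ℕ) : ZMod (p ^ 2)) = (-1) ^ m * tripChoose m := by
  have h := cast_descFactorial_add' p m (3 * m)
  rw [show m + 1 + 3 * m = 4 * m + 1 by ring, ← quadChoose_mul_choose] at h
  have hp0 : (p : ℤ) ≠ 0 := by exact_mod_cast hp.out.ne_zero
  rw [← hm, mul_assoc, Nat.cast_mul] at h
  have h := mul_left_cancel₀ hp0 h
  rw [show 3 * m = m + 2 * m by ring, prod_range_add] at h
  have h2 := congrArg (Int.cast : ℤ → ZMod (p ^ 2)) h
  have h3 := congrArg (Nat.cast : ℕ → ZMod (p ^ 2)) (tripChoose_mul m)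
  have h4 := factorial_mul_prod_range (p := p) m
  have h5 := prod_add_mul_prod_sub (p := p) m
  have h6 := prod_sub_add m hm
  have hu := (isUnit_factorial (p := p) (show m < p by omega)).pow 5
  rw [← hm]
  push_cast at h2 h3 h4 h6 ⊢
  rw [h6, ← mul_assoc (∏ j ∈ range m, ((p : ZMod (p ^ 2)) + (j + 1))), h5] at h2
  refine hu.mul_left_cancel ?_
  linear_combination (m.factorial : ZMod (p ^ 2)) * h2 +
    (-1) ^ m * (m.factorial : ZMod (p ^ 2)) ^ 2 * h4 - (-1) ^ m * (m.factorial : ZMod (p ^ 2)) ^ 2 * h3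

lemma quadChoose_mul_choose_add_three_mul_self {m : ℕ} (hm : p = 4 * m + 1) :
    ((quadChoose m * (p + 3 * m).choose (4 * m + 1) : ℕ) : ZMod (p ^ 2)) =
      (-1) ^ m * tripChoose m := by
  have h := cast_descFactorial_add' p (3 * m) m
  rw [show 3 * m + 1 + m = 4 * m + 1 by ring, ← quadChoose_mul_choose] at h
  have hp0 : (p : ℤ) ≠ 0 := by exact_mod_cast hp.out.ne_zero
  rw [← hm, mul_assoc, Nat.cast_mul] at h
  have h := mul_left_cancel₀ hp0 h
  rw [show range (3 * m) = range (m + 2 * m) by congr 1; ring, prod_range_add] at h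
  have h2 := congrArg (Int.cast : ℤ → ZMod (p ^ 2)) h
  have h3 := congrArg (Nat.cast : ℕ → ZMod (p ^ 2)) (tripChoose_mul m)
  have h4 := factorial_mul_prod_range (p := p) m
  have h5 := prod_add_mul_prod_sub (p := p) m
  have h6 := prod_add_add m hm
  have hu := (isUnit_factorial (p := p) (show m < p by omega)).pow 5
  rw [← hm]
  push_cast at h2 h3 h4 h6 ⊢
  rw [h6, mul_right_comm, h5] at h2
  refine hu.mul_left_cancel ?_
  linear_combination (m.factorial : ZMod (p ^ 2)) * h2 +
    (-1) ^ m * (m.factorial : ZMod (p ^ 2)) ^ 2 * h4 - (-1) ^ m * (m.factorial : ZMod (p ^ 2)) ^ 2 * h3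

end Terms

lemma sum_az_mul_pow {A : Type*} [CommRing A] (N : ℕ) {c : A} (hc : (-3) * c = 1) :
    ∑ n ∈ range N, (az n : A) * c ^ n =
      ∑ k ∈ range N, ((quadChoose k * (N + k).choose (4 * k + 1) : ℕ) : A) * (c ^ 3) ^ k := by
  have h1 : ∀ n ∈ range N, (az n : A) * c ^ n =
      ∑ k ∈ range N, ((quadChoose k * (n + k).choose (4 * k) : ℕ) : A) * (c ^ 3) ^ k := by
    intro n hn
    rw [az_eq_sum n N (mem_range.mp hn)]
    push_cast
    rw [sum_mul]
    refine sum_congr rfl fun k _ => ?_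
    rcases lt_or_ge n (3 * k) with h | h
    · simp [Nat.choose_eq_zero_of_lt (show n + k < 4 * k by omega)]
    · obtain ⟨l, rfl⟩ := Nat.exists_eq_add_of_le h
      have : (-3 : A) ^ l * c ^ l = 1 := by rw [← mul_pow, hc, one_pow]
      rw [Nat.add_sub_cancel_left, pow_add, pow_mul]
      linear_combination (quadChoose k : A) * (3 * k + l + k).choose (4 * k) * (c ^ 3) ^ k * this
  rw [sum_congr rfl h1, sum_comm]
  refine sum_congr rfl fun k _ => ?_
  rw [← sum_range_choose_add (show k ≤ 4 * k by omega), ← sum_mul, mul_sum, Nat.cast_sum]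

lemma sum_az_mul_pow' {A : Type*} [CommRing A] (N : ℕ) {d : A} (hd : (-27) * d = 1) :
    ∑ n ∈ range N, (az n : A) * d ^ n =
      ∑ k ∈ range N, ((quadChoose k * (N + 3 * k).choose (4 * k + 1) : ℕ) : A) * d ^ k := by
  have h1 : ∀ n ∈ range N, (az n : A) * d ^ n =
      ∑ k ∈ range (N + 1), ((quadChoose k * (n + 3 * k).choose (4 * k) : ℕ) : A) * d ^ k := by
    intro n hn
    rw [mem_range] at hn
    rw [az_eq_sum' n (N + 1) (by omega)]
    push_cast
    rw [sum_mul]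
    refine sum_congr rfl fun k _ => ?_
    rcases lt_or_ge n k with h | h
    · simp [Nat.choose_eq_zero_of_lt (show n + 3 * k < 4 * k by omega)]
    · obtain ⟨l, rfl⟩ := Nat.exists_eq_add_of_le h
      have : (-27 : A) ^ l * d ^ l = 1 := by rw [← mul_pow, hd, one_pow]
      rw [Nat.add_sub_cancel_left, pow_add]
      linear_combination (quadChoose k : A) * (k + l + 3 * k).choose (4 * k) * d ^ k * this
  rw [sum_congr rfl h1, sum_comm]
  have h2 : ∀ k ∈ range (N + 1),
      ∑ n ∈ range N, ((quadChoose k * (n + 3 * k).choose (4 * k) : ℕ) : A) * d ^ k =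
      ((quadChoose k * (N + 3 * k).choose (4 * k + 1) : ℕ) : A) * d ^ k := by
    intro k _
    rw [← sum_range_choose_add (show 3 * k ≤ 4 * k by omega), ← sum_mul, mul_sum, Nat.cast_sum]
  rw [sum_congr rfl h2, sum_range_succ,
    Nat.choose_eq_zero_of_lt (show N + 3 * N < 4 * N + 1 by omega)]
  simp

section Central

variable {p : ℕ} [hp : Fact p.Prime]

lemma three_mul_third_cast (h3 : p ≠ 3) :
    (3 * ((p / 3 : ℕ) : ZMod p) + 1) * (3 * ((p / 3 : ℕ) : ZMod p) + 2) = 0 := by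
  have h : ¬ 3 ∣ p := fun h => h3 ((Nat.prime_dvd_prime_iff_eq Nat.prime_three hp.out).mp h).symm
  rcases (by omega : 3 * (p / 3) + 1 = p ∨ 3 * (p / 3) + 2 = p) with h | h
  · have := congrArg (Nat.cast : ℕ → ZMod p) h
    push_cast at this
    rw [this]; simp
  · have := congrArg (Nat.cast : ℕ → ZMod p) h
    push_cast at this
    rw [this]; simp

lemma legCoeff_mul_factorial (h3 : p ≠ 3) (k : ℕ) :
    27 ^ k * (legCoeff (p / 3) k : ZMod p) * (k.factorial : ZMod p) ^ 3 =
      ((3 * k).factorial : ZMod p) := by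
  have h2 := three_mul_third_cast h3
  generalize p / 3 = n at h2 ⊢
  induction k with
  | zero => simp [legCoeff]
  | succ k ih =>
    have h1 := congrArg (Int.cast : ℤ → ZMod p) (legCoeff_succ n k)
    rw [show 3 * (k + 1) = 3 * k + 2 + 1 by ring, Nat.factorial_succ, Nat.factorial_succ,
      Nat.factorial_succ, Nat.factorial_succ]
    push_cast at h1 ⊢
    rw [← ih]
    linear_combination (27 ^ (k + 1) * ((k : ZMod p) + 1) * (k.factorial : ZMod p) ^ 3) * h1 -
      3 * 27 ^ k * (k + 1) * (k.factorial : ZMod p) ^ 3 * (legCoeff n k : ZMod p) * h2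

lemma tripChoose_cast (h3 : p ≠ 3) {k : ℕ} (hk : k < p) :
    (tripChoose k : ZMod p) = 27 ^ k * (legCoeff (p / 3) k : ZMod p) := by
  have h1 := congrArg (Nat.cast : ℕ → ZMod p) (tripChoose_mul k)
  push_cast at h1
  rw [← legCoeff_mul_factorial h3] at h1
  exact mul_right_cancel₀ (pow_ne_zero 3 (factorial_zmod_ne_zero hk)) h1

/-- A sum of reciprocals modulo `p`, from `p / 6` to `p / 2`. -/
def recipSum (p m : ℕ) [Fact p.Prime] : ZMod p :=
  ∑ j ∈ Ico (2 * (p / 3) - 2 * m) (2 * m), 1 / ((j : ZMod p) + 1)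

lemma four_mul_cast {m : ℕ} (hm : p = 4 * m + 1) : (4 * m : ZMod p) = -1 := by
  have : ((4 * m + 1 : ℕ) : ZMod p) = 0 := by rw [← hm]; simp
  push_cast at this
  linear_combination this

omit hp in
lemma natCast_self_eq {m : ℕ} (hm : p = 4 * m + 1) :
    (p : ZMod (p ^ 2)) = 4 * (m : ZMod (p ^ 2)) + 1 := by
  have := congrArg (Nat.cast : ℕ → ZMod (p ^ 2)) hm
  push_cast at this
  exact this

lemma two_zmod_ne_zero {m : ℕ} (hm : p = 4 * m + 1) (hm0 : m ≠ 0) : (2 : ZMod p) ≠ 0 := by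
  exact_mod_cast natCast_zmod_ne_zero (p := p) (k := 2) (by norm_num) (by omega)

lemma sum_range_recip {m n : ℕ} (hmn : m ≤ n) (hnm : n ≤ 2 * m) :
    ∑ l ∈ range (2 * n + 1), 1 / ((l : ZMod p) - (2 * m : ℕ)) =
      -∑ j ∈ Ico (2 * n - 2 * m) (2 * m), 1 / ((j : ZMod p) + 1) := by
  have h1 : ∑ l ∈ range (2 * m), 1 / ((l : ZMod p) - (2 * m : ℕ)) =
      -∑ j ∈ range (2 * m), 1 / ((j : ZMod p) + 1) := by
    rw [← sum_range_reflect, ← sum_neg_distrib]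
    refine sum_congr rfl fun j hj => ?_
    rw [mem_range] at hj
    have : ((2 * m : ℕ) : ZMod p) = ((2 * m - 1 - j : ℕ) : ZMod p) + ((j + 1 : ℕ) : ZMod p) := by
      rw [← Nat.cast_add]; congr 1; omega
    rw [this, ← one_div_neg_eq_neg_one_div]
    congr 1
    push_cast
    ring
  have h2 := sum_range_add_sum_Ico (fun j : ℕ => 1 / ((j : ZMod p) + 1))
    (show 2 * n - 2 * m ≤ 2 * m by omega)
  rw [show 2 * n + 1 = 2 * m + (1 + (2 * n - 2 * m)) by omega, sum_range_add, h1, ← h2,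
    sum_range_add]
  have h3 : ∑ x ∈ range (2 * n - 2 * m), 1 / (((2 * m + (1 + x) : ℕ) : ZMod p) - (2 * m : ℕ)) =
      ∑ x ∈ range (2 * n - 2 * m), 1 / ((x : ZMod p) + 1) := by
    refine sum_congr rfl fun j _ => ?_
    congr 1
    push_cast
    ring
  rw [h3]
  simp

lemma sum_range_even_odd {M : Type*} [AddCommMonoid M] (f : ℕ → M) (n : ℕ) :
    ∑ l ∈ range (2 * n + 1), f l =
      ∑ i ∈ range n, f (2 * i + 1) + ∑ i ∈ range (n + 1), f (2 * i) := by
  induction n with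
  | zero => simp
  | succ n ih =>
    rw [sum_range_succ (fun i => f (2 * i + 1)), sum_range_succ (fun i => f (2 * i)) (n + 1),
      show 2 * (n + 1) = 2 * n + 1 + 1 by ring, sum_range_succ, sum_range_succ, ih]
    abel

lemma sum_recip_eq {m n : ℕ} (hm : p = 4 * m + 1) (hm0 : m ≠ 0) {z : ZMod p} (hz : 4 * z = 1) :
    ∑ i ∈ range n, z / ((i : ZMod p) + 1 + (m : ZMod p)) + ∑ i ∈ range (n + 1), z / ((i : ZMod p) - (m : ZMod p)) =
      1 / 2 * ∑ l ∈ range (2 * n + 1), 1 / ((l : ZMod p) - (2 * m : ℕ)) := by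
  have h4 := four_mul_cast hm
  have h2 := two_zmod_ne_zero hm hm0
  have hz0 : z ≠ 0 := by rintro rfl; simp at hz
  have hz' : z = 1 / 2 * (1 / 2) := by
    field_simp
    linear_combination hz
  rw [sum_range_even_odd, mul_add, mul_sum, mul_sum]
  congr 1
  · refine sum_congr rfl fun i _ => ?_
    have : ((2 * i + 1 : ℕ) : ZMod p) - (2 * m : ℕ) = 2 * ((i : ZMod p) + 1 + (m : ZMod p)) := by
      push_cast
      linear_combination -h4
    rw [this, one_div_mul_eq_div, hz', ← one_div_mul_one_div]
    ring
  · refine sum_congr rfl fun i _ => ?_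
    have : ((2 * i : ℕ) : ZMod p) - (2 * m : ℕ) = 2 * ((i : ZMod p) - (m : ZMod p)) := by
      push_cast
      ring
    rw [this, hz', ← one_div_mul_one_div]
    ring

lemma resid_intCast_sub_ne_zero {i j : ℕ} (hi : i < p) (hj : j < p) (hij : i ≠ j) :
    resid p ((i : ZMod (p ^ 2)) - (j : ZMod (p ^ 2))) ≠ 0 := by
  rw [map_sub, map_natCast, map_natCast, sub_ne_zero]
  intro h
  rw [ZMod.natCast_eq_natCast_iff'] at h
  rw [Nat.mod_eq_of_lt hi, Nat.mod_eq_of_lt hj] at h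
  exact hij h

lemma prod_sub_eq_mul_oneUnit {m : ℕ} (hm : p = 4 * m + 1) (hm0 : m ≠ 0)
    {z : ZMod (p ^ 2)} (hz : 4 * z = 1) :
    ∏ i ∈ range (p / 3), ((i : ZMod (p ^ 2)) + 1 - z) =
      (legCoeff (p / 3) m : ZMod (p ^ 2)) * (∏ i ∈ (range (p / 3 + 1)).erase m, (z + (i : ZMod (p ^ 2)))) *
        oneUnit (1 / 2 * recipSum p m) := by
  set n := p / 3 with hn
  have hmn : m ≤ n := by omega
  have hnm : n ≤ 2 * m := by omega
  have hzm : z + (m : ZMod (p ^ 2)) = (p : ZMod (p ^ 2)) * z := by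
    have := natCast_self_eq hm
    linear_combination (-z) * this - m * hz
  have h4 : 4 * resid p z = 1 := by
    have := congrArg (resid p) hz
    rwa [map_mul, map_ofNat, map_one] at this
  have hD : ∏ i ∈ (range (n + 1)).erase m, (z + (i : ZMod (p ^ 2))) =
      (∏ i ∈ (range (n + 1)).erase m, ((i : ZMod (p ^ 2)) - (m : ZMod (p ^ 2)))) *
        oneUnit (∑ i ∈ range (n + 1), resid p z / ((i : ZMod p) - (m : ZMod p))) := by
    rw [← sum_erase (a := m) (range (n + 1)) (by simp)]
    have := prod_add_natCast_mul ((range (n + 1)).erase m) (fun i : ℕ => (i : ZMod (p ^ 2)) - (m : ZMod (p ^ 2))) z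
      (fun i hi => by
        rw [mem_erase, mem_range] at hi
        exact resid_intCast_sub_ne_zero (by omega) (by omega) hi.1)
    simp only [map_sub, map_natCast] at this
    rw [← this]
    refine prod_congr rfl fun i _ => ?_
    linear_combination hzm
  have hM : ∏ i ∈ range n, ((i : ZMod (p ^ 2)) + 1 - z) =
      (∏ i ∈ range n, ((i : ZMod (p ^ 2)) + 1 + (m : ZMod (p ^ 2)))) *
        oneUnit (-∑ i ∈ range n, resid p z / ((i : ZMod p) + 1 + (m : ZMod p))) := by
    have := prod_add_natCast_mul (range n) (fun i : ℕ => (i : ZMod (p ^ 2)) + 1 + (m : ZMod (p ^ 2))) (-z)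
      (fun i hi => by
        rw [mem_range] at hi
        simp only [map_add, map_natCast, map_one]
        exact_mod_cast natCast_zmod_ne_zero (p := p) (k := i + 1 + m) (by omega) (by omega))
    simp only [map_add, map_natCast, map_one, map_neg, neg_div, sum_neg_distrib] at this
    rw [← this]
    refine prod_congr rfl fun i _ => ?_
    linear_combination -hzm
  have hleg := congrArg (Int.cast : ℤ → ZMod (p ^ 2)) (legCoeff_mul_prod n m hmn)
  push_cast at hleg
  rw [hD, hM, ← hleg, mul_assoc, mul_assoc, mul_assoc, ← oneUnit_add]
  congr 3
  have h5 := sum_recip_eq (n := n) hm hm0 h4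
  rw [sum_range_recip hmn hnm] at h5
  unfold recipSum
  linear_combination -h5

lemma sum_eq_mul_oneUnit {m : ℕ} (hm : p = 4 * m + 1) (hm0 : m ≠ 0) {X : ℕ → ZMod (p ^ 2)}
    (hX : ∀ k < p, (4 * (k : ZMod (p ^ 2)) + 1) * X k =
      (p : ZMod (p ^ 2)) * (-1) ^ k * (tripChoose k : ZMod (p ^ 2)))
    (hXm : X m = (-1) ^ m * (tripChoose m : ZMod (p ^ 2))) {d : ZMod (p ^ 2)} (hd : (-27) * d = 1) :
    ∑ k ∈ range p, X k * d ^ k = X m * d ^ m * oneUnit (1 / 2 * recipSum p m) := by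
  have h3 : p ≠ 3 := by omega
  set n := p / 3 with hn
  have hmn : m ≤ n := by omega
  have hd' : 27 * resid p (-d) = 1 := by
    have := congrArg (resid p) hd
    simp only [map_mul, map_neg, map_one, map_ofNat] at this ⊢
    linear_combination this
  have hres : ∀ k < p, resid p ((-d) ^ k * (tripChoose k : ZMod (p ^ 2))) = (legCoeff n k : ZMod p) := by
    intro k hk
    rw [map_mul, map_pow, map_natCast, tripChoose_cast h3 hk, ← mul_assoc, ← mul_pow,
      mul_comm _ (27 : ZMod p), hd', one_pow, one_mul]
  have hpres : ∀ k < p, (p : ZMod (p ^ 2)) * ((-d) ^ k * (tripChoose k : ZMod (p ^ 2))) =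
      (p : ZMod (p ^ 2)) * (legCoeff n k : ZMod (p ^ 2)) := by
    intro k hk
    exact natCast_mul_eq_of_resid_eq (by rw [hres k hk, map_intCast])
  have hf : ∀ k < p, (4 * (k : ZMod (p ^ 2)) + 1) * (X k * d ^ k) =
      (p : ZMod (p ^ 2)) * (legCoeff n k : ZMod (p ^ 2)) := by
    intro k hk
    rw [← hpres k hk, ← mul_assoc, hX k hk, neg_pow]
    ring
  have hfm : X m * d ^ m = (-d) ^ m * (tripChoose m : ZMod (p ^ 2)) := by
    rw [hXm, neg_pow]; ring
  have hunit : ∀ k < p, k ≠ m → IsUnit (4 * (k : ZMod (p ^ 2)) + 1) := by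
    intro k hk hkm
    have h1 : (4 : ZMod (p ^ 2)) * (k : ZMod (p ^ 2)) + 1 = 4 * ((k : ZMod (p ^ 2)) - (m : ZMod (p ^ 2))) + (p : ZMod (p ^ 2)) := by
      have := natCast_self_eq hm
      linear_combination -this
    refine isUnit_of_resid_ne_zero ?_
    rw [h1, map_add, map_mul, map_natCast _ p, CharP.cast_eq_zero (ZMod p) p, add_zero, map_ofNat]
    refine mul_ne_zero ?_ (resid_intCast_sub_ne_zero hk (by omega) hkm)
    rw [show (4 : ZMod p) = 2 * 2 by norm_num]
    exact mul_ne_zero (two_zmod_ne_zero hm hm0) (two_zmod_ne_zero hm hm0)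
  have hu4 : IsUnit (4 : ZMod (p ^ 2)) := by
    exact_mod_cast isUnit_natCast (p := p) (k := 4) (by norm_num) (by omega)
  obtain ⟨z, hz⟩ := hu4.exists_right_inv
  have hzm : z + (m : ZMod (p ^ 2)) = (p : ZMod (p ^ 2)) * z := by
    have := natCast_self_eq hm
    linear_combination (-z) * this - m * hz
  have hmem : m ∈ range (n + 1) := mem_range.mpr (by omega)
  set D := ∏ i ∈ (range (n + 1)).erase m, (z + (i : ZMod (p ^ 2))) with hD
  have hDu : IsUnit D := by
    refine isUnit_of_resid_ne_zero ?_
    rw [hD, map_prod, prod_ne_zero_iff]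
    intro i hi
    rw [mem_erase, mem_range] at hi
    have : z + (i : ZMod (p ^ 2)) =
        ((i : ZMod (p ^ 2)) - (m : ZMod (p ^ 2))) + (p : ZMod (p ^ 2)) * z := by linear_combination hzm
    rw [this, map_add, map_mul, map_natCast _ p, CharP.cast_eq_zero (ZMod p) p, zero_mul, add_zero]
    exact resid_intCast_sub_ne_zero (by omega) (by omega) hi.1
  have hterm : ∀ k ∈ range (n + 1), k ≠ m → X k * d ^ k * D =
      (legCoeff n k : ZMod (p ^ 2)) * ∏ i ∈ (range (n + 1)).erase k, (z + (i : ZMod (p ^ 2))) := by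
    intro k hk hkm
    have hkp : k < p := by rw [mem_range] at hk; omega
    refine (hunit k hkp hkm).mul_left_cancel ?_
    have e1 := mul_prod_erase (range (n + 1)) (fun i : ℕ => z + (i : ZMod (p ^ 2))) hk
    have e2 := mul_prod_erase (range (n + 1)) (fun i : ℕ => z + (i : ZMod (p ^ 2))) hmem
    rw [← e1, ← hD, hzm] at e2
    linear_combination D * hf k hkp + legCoeff n k * 4 * e2 - p * legCoeff n k * D * hz +
      (legCoeff n k * (∏ i ∈ (range (n + 1)).erase k, (z + (i : ZMod (p ^ 2))))) * hz
  have hsum : ∑ k ∈ range p, X k * d ^ k = ∑ k ∈ range (n + 1), X k * d ^ k := by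
    symm
    refine sum_subset (range_subset_range.mpr (by omega)) fun k hk hk' => ?_
    rw [mem_range] at hk hk'
    refine (hunit k hk (by omega)).mul_left_cancel ?_
    rw [hf k hk, legCoeff_eq_zero (by omega)]
    simp
  have hleg := sum_legCoeff_mul_prod n z
  rw [prod_sub_eq_mul_oneUnit hm hm0 hz, ← hn, ← hD, ← sum_erase_add _ _ hmem, ← hD] at hleg
  rw [hsum]
  refine hDu.mul_right_cancel ?_
  rw [← sum_erase_add _ _ hmem, add_mul, sum_mul, sum_congr rfl fun k hk =>
    hterm k (mem_of_mem_erase hk) (ne_of_mem_erase hk)]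
  have h5 := hpres m (by omega)
  rw [hfm]
  unfold oneUnit at hleg ⊢
  linear_combination hleg - D * ((1 / 2 * recipSum p m).val : ZMod (p ^ 2)) * h5

lemma prod_sq_three_mul {m : ℕ} (hm : p = 4 * m + 1) :
    ∏ j ∈ range (2 * m), (if j < 2 * (p / 3) - 2 * m then (3 * (j + 1) : ℤ) else
      3 * (j + 1) - p) ^ 2 = ((2 * m).factorial : ℤ) ^ 2 := by
  have h3 : ¬ 3 ∣ p := fun h => by
    have := (Nat.prime_dvd_prime_iff_eq Nat.prime_three hp.out).mp h
    omega
  set f : ℕ → ℤ := fun j => if j < 2 * (p / 3) - 2 * m then (3 * (j + 1) : ℤ) else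
    3 * (j + 1) - p with hf
  have hmaps : Set.MapsTo (fun j => (f j).natAbs - 1) (range (2 * m)) (range (2 * m)) := by
    intro j hj
    simp only [hf, coe_range, Set.mem_Iio] at hj ⊢
    split_ifs <;> omega
  have hinj : Set.InjOn (fun j => (f j).natAbs - 1) (range (2 * m)) := by
    intro i hi j hj h
    simp only [hf, coe_range, Set.mem_Iio] at hi hj h
    split_ifs at h <;> omega
  have hsurj : Set.SurjOn (fun j => (f j).natAbs - 1) (range (2 * m)) (range (2 * m)) :=
    surjOn_of_injOn_of_card_le _ hmaps hinj le_rfl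
  rw [← prod_range_add_one_eq_factorial]
  push_cast
  rw [← prod_pow]
  refine prod_nbij _ (fun j hj => hmaps hj) hinj hsurj fun j hj => ?_
  have h1 : 0 < (f j).natAbs := by
    rw [mem_range] at hj
    rw [Int.natAbs_pos]
    simp only [hf]
    intro h0
    split_ifs at h0 <;> omega
  have h2 : ((f j).natAbs - 1 : ℕ) + 1 = (f j).natAbs := by omega
  have h3 : (((f j).natAbs - 1 : ℕ) : ℤ) + 1 = ((f j).natAbs : ℤ) := by exact_mod_cast h2
  change f j ^ 2 = _
  rw [h3, Int.natAbs_sq]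

lemma three_pow_eq_oneUnit {m : ℕ} (hm : p = 4 * m + 1) (hm0 : m ≠ 0) :
    (3 : ZMod (p ^ 2)) ^ (4 * m) = oneUnit (2 / 3 * recipSum p m) := by
  set t := 2 * (p / 3) - 2 * m with ht
  have h3 : ¬ 3 ∣ p := fun h => by
    have := (Nat.prime_dvd_prime_iff_eq Nat.prime_three hp.out).mp h
    omega
  have h30 : (3 : ZMod p) ≠ 0 := by
    exact_mod_cast natCast_zmod_ne_zero (p := p) (k := 3) (by norm_num) (by omega)
  have ht2 : t ≤ 2 * m := by omega
  set f : ℕ → ℤ := fun j => if j < t then (3 * (j + 1) : ℤ) else 3 * (j + 1) - p with hf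
  have h1 : ∏ j ∈ Ico t (2 * m), (3 * ((j : ZMod (p ^ 2)) + 1)) =
      (∏ j ∈ Ico t (2 * m), (f j : ZMod (p ^ 2))) * oneUnit (1 / 3 * recipSum p m) := by
    have hr : ∀ j ∈ Ico t (2 * m), resid p (f j : ZMod (p ^ 2)) = 3 * ((j : ZMod p) + 1) := by
      intro j hj
      rw [mem_Ico] at hj
      simp only [hf]
      rw [if_neg (by omega)]
      push_cast
      simp only [map_sub, map_mul, map_add, map_natCast, map_one, map_ofNat, CharP.cast_eq_zero,
        sub_zero]
    have := prod_add_natCast_mul (Ico t (2 * m)) (fun j => (f j : ZMod (p ^ 2))) 1 (fun j hj => by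
      rw [hr j hj]
      rw [mem_Ico] at hj
      refine mul_ne_zero h30 ?_
      exact_mod_cast natCast_zmod_ne_zero (p := p) (k := j + 1) (by omega) (by omega))
    have hs : ∑ i ∈ Ico t (2 * m), resid p 1 / resid p (f i : ZMod (p ^ 2)) =
        1 / 3 * recipSum p m := by
      rw [recipSum, mul_sum]
      refine sum_congr rfl fun j hj => ?_
      rw [hr j hj, map_one, one_div_mul_one_div]
    rw [hs] at this
    rw [← this]
    refine prod_congr rfl fun j hj => ?_
    rw [mem_Ico] at hj
    simp only [hf]
    rw [if_neg (by omega)]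
    push_cast
    ring
  have h2 : ∏ j ∈ range t, (3 * ((j : ZMod (p ^ 2)) + 1)) =
      ∏ j ∈ range t, (f j : ZMod (p ^ 2)) := by
    refine prod_congr rfl fun j hj => ?_
    rw [mem_range] at hj
    simp only [hf]
    rw [if_pos hj]
    push_cast
    ring
  have h4 : ∏ j ∈ range (2 * m), (3 * ((j : ZMod (p ^ 2)) + 1)) =
      (∏ j ∈ range (2 * m), (f j : ZMod (p ^ 2))) * oneUnit (1 / 3 * recipSum p m) := by
    rw [← prod_range_mul_prod_Ico _ ht2, ← prod_range_mul_prod_Ico _ ht2, h1, h2, mul_assoc]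
  rw [prod_mul_distrib, prod_const, card_range, prod_range_cast_succ] at h4
  have h5 := congrArg (Int.cast : ℤ → ZMod (p ^ 2)) (prod_sq_three_mul hm)
  rw [prod_pow] at h5
  push_cast only [Int.cast_pow, Int.cast_prod] at h5
  have h6 : oneUnit (2 / 3 * recipSum p m) = oneUnit (1 / 3 * recipSum p m) ^ 2 := by
    rw [← oneUnit_natCast_mul]
    congr 1
    push_cast
    ring
  have hu := (isUnit_factorial (p := p) (show 2 * m < p by omega)).pow 2
  refine hu.mul_left_cancel ?_
  rw [h6]
  have h7 := congrArg (· ^ 2) h4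
  simp only [mul_pow] at h7
  have h8 : (∏ j ∈ range (2 * m), (f j : ZMod (p ^ 2))) ^ 2 =
      ((2 * m).factorial : ZMod (p ^ 2)) ^ 2 := by
    simpa [hf] using h5
  rw [h8, ← pow_mul] at h7
  rw [← h7, show 2 * m * 2 = 4 * m by ring]
  ring

lemma sum_mul_three_pow {m : ℕ} (hm : p = 4 * m + 1) (hm0 : m ≠ 0) {X : ℕ → ZMod (p ^ 2)}
    (hX : ∀ k < p, (4 * (k : ZMod (p ^ 2)) + 1) * X k =
      (p : ZMod (p ^ 2)) * (-1) ^ k * (tripChoose k : ZMod (p ^ 2)))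
    (hXm : X m = (-1) ^ m * (tripChoose m : ZMod (p ^ 2))) {d : ZMod (p ^ 2)} (hd : (-27) * d = 1) :
    (∑ k ∈ range p, X k * d ^ k) * 3 ^ (3 * m * p) = (tripChoose m : ZMod (p ^ 2)) := by
  have h30 : (3 : ZMod p) ≠ 0 := by
    exact_mod_cast natCast_zmod_ne_zero (p := p) (k := 3) (by norm_num) (by omega)
  have h20 := two_zmod_ne_zero hm hm0
  have h4 := four_mul_cast hm
  have h1 : (3 : ZMod (p ^ 2)) ^ (3 * m * p) =
      27 ^ m * oneUnit (-(1 / 2) * recipSum p m) := by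
    have e : 3 * m * p = 3 * m + 4 * m * (3 * m) := by
      conv_lhs => rw [hm]
      ring
    rw [e, pow_add, pow_mul, pow_mul, three_pow_eq_oneUnit hm hm0, ← oneUnit_natCast_mul]
    congr 1
    · norm_num
    · congr 1
      push_cast
      have e3 : (3 : ZMod p) * (2 / 3) = 2 := by field_simp
      have e2 : (2 : ZMod p) * (1 / 2) = 1 := by field_simp
      linear_combination (m * recipSum p m) * e3 + (1 / 2 * recipSum p m) * h4 -
        2 * m * recipSum p m * e2
  have h2 : (27 : ZMod (p ^ 2)) ^ m * ((-1) ^ m * d ^ m) = 1 := by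
    rw [← mul_pow, ← mul_pow]
    rw [show (27 : ZMod (p ^ 2)) * (-1 * d) = 1 by linear_combination hd, one_pow]
  have h3 : oneUnit (1 / 2 * recipSum p m) * oneUnit (-(1 / 2) * recipSum p m) = 1 := by
    rw [← oneUnit_add, ← oneUnit_zero]
    congr 1
    ring
  rw [sum_eq_mul_oneUnit hm hm0 hX hXm hd, h1, hXm]
  linear_combination (tripChoose m : ZMod (p ^ 2)) * h3 +
    tripChoose m * oneUnit (1 / 2 * recipSum p m) * oneUnit (-(1 / 2) * recipSum p m) * h2

end Central

section Teichmuller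

variable {p : ℕ} [hp : Fact p.Prime]

omit hp in
lemma add_mul_pow (a b : ZMod (p ^ 2)) (k : ℕ) :
    (a + (p : ZMod (p ^ 2)) * b) ^ k =
      a ^ k + (k : ZMod (p ^ 2)) * a ^ (k - 1) * ((p : ZMod (p ^ 2)) * b) := by
  obtain ⟨c, hc⟩ := Polynomial.powAddExpansion a ((p : ZMod (p ^ 2)) * b) k
  rw [hc]
  linear_combination c * b ^ 2 * natCast_mul_self_eq_zero (p := p)

lemma pow_prime_eq_of_resid_eq {x y : ZMod (p ^ 2)} (h : resid p x = resid p y) :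
    x ^ p = y ^ p := by
  obtain ⟨w, rfl⟩ := exists_of_resid_eq h
  rw [add_mul_pow]
  linear_combination y ^ (p - 1) * w * natCast_mul_self_eq_zero (p := p)

/-- The Teichmüller lift from `ℤ/p` to `ℤ/p²`. -/
def teich (x : ZMod p) : ZMod (p ^ 2) := (x.val : ZMod (p ^ 2)) ^ p

lemma teich_resid (x : ZMod (p ^ 2)) : teich (resid p x) = x ^ p :=
  pow_prime_eq_of_resid_eq (resid_natCast_val _)

lemma resid_teich (x : ZMod p) : resid p (teich x) = x := by
  rw [teich, map_pow, resid_natCast_val, ZMod.pow_card]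

lemma teich_mul (x y : ZMod p) : teich (x * y) = teich x * teich y := by
  rw [← resid_natCast_val x, ← resid_natCast_val y, ← map_mul]
  simp only [teich_resid, mul_pow]

lemma teich_one : teich (1 : ZMod p) = 1 := by
  rw [← map_one (resid p), teich_resid, one_pow]

lemma teich_zero : teich (0 : ZMod p) = 0 := by
  rw [← map_zero (resid p), teich_resid, zero_pow hp.out.ne_zero]

lemma teich_neg {m : ℕ} (hm : p = 4 * m + 1) (x : ZMod p) : teich (-x) = -teich x := by
  have h : Odd p := ⟨2 * m, by omega⟩
  rw [← resid_natCast_val x, ← map_neg, teich_resid, teich_resid, h.neg_pow]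

lemma teich_pow (x : ZMod p) (k : ℕ) : teich (x ^ k) = teich x ^ k := by
  induction k with
  | zero => rw [pow_zero, pow_zero, teich_one]
  | succ k ih => rw [pow_succ x, pow_succ (teich x), teich_mul, ih]

lemma teich_pow_card_sub_one {x : ZMod p} (hx : x ≠ 0) : teich x ^ (p - 1) = 1 := by
  rw [← teich_pow, ZMod.pow_card_sub_one_eq_one hx, teich_one]

lemma sum_teich_pow_of_dvd {j : ℕ} (hj : j ≠ 0) (h : p - 1 ∣ j) :
    ∑ x : ZMod p, teich x ^ j = (p : ZMod (p ^ 2)) - 1 := by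
  obtain ⟨l, rfl⟩ := h
  rw [← sum_erase_add _ _ (mem_univ (0 : ZMod p)), teich_zero, zero_pow hj, add_zero,
    sum_congr rfl (g := fun _ => (1 : ZMod (p ^ 2)))]
  · rw [sum_const, card_erase_of_mem (mem_univ _), card_univ, ZMod.card, nsmul_eq_mul, mul_one,
      Nat.cast_sub hp.out.one_le, Nat.cast_one]
  · intro x hx
    rw [pow_mul, teich_pow_card_sub_one (ne_of_mem_erase hx), one_pow]

lemma sum_teich_pow_of_not_dvd {j : ℕ} (h : ¬ p - 1 ∣ j) :
    ∑ x : ZMod p, teich x ^ j = 0 := by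
  obtain ⟨g, hg⟩ := IsCyclic.exists_generator (α := (ZMod p)ˣ)
  have hg1 : (g : ZMod p) ^ j ≠ 1 := by
    intro h1
    refine h ?_
    rw [← ZMod.card_units p, ← Nat.card_eq_fintype_card, ← orderOf_eq_card_of_forall_mem_zpowers hg]
    exact orderOf_dvd_of_pow_eq_one (Units.ext (by simpa using h1))
  have h1 : ∑ x : ZMod p, teich x ^ j = teich (g : ZMod p) ^ j * ∑ x : ZMod p, teich x ^ j := by
    rw [mul_sum, ← Equiv.sum_comp (Units.mulLeft g)]
    refine sum_congr rfl fun x _ => ?_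
    rw [Units.mulLeft_apply, teich_mul, mul_pow]
  have hu : IsUnit (teich (g : ZMod p) ^ j - 1) := by
    refine isUnit_of_resid_ne_zero ?_
    rw [map_sub, map_pow, resid_teich, map_one, sub_ne_zero]
    exact hg1
  refine hu.mul_right_cancel ?_
  linear_combination -h1

lemma sum_teich_mul_add_pow {m : ℕ} (hm : p = 4 * m + 1) (c : ZMod (p ^ 2)) {N : ℕ}
    (hN : N < 9 * m) :
    ∑ x : ZMod p, teich x ^ (3 * m) * (c + teich x) ^ N =
      ((p : ZMod (p ^ 2)) - 1) * ((N.choose m : ZMod (p ^ 2)) * c ^ (N - m) +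
        (N.choose (5 * m) : ZMod (p ^ 2)) * c ^ (N - 5 * m)) := by
  have h1 : ∀ x : ZMod p, teich x ^ (3 * m) * (c + teich x) ^ N =
      ∑ b ∈ range (9 * m), ((N.choose b : ZMod (p ^ 2)) * c ^ (N - b)) * teich x ^ (3 * m + b) := by
    intro x
    rw [add_comm c, add_pow, mul_sum]
    refine (sum_congr rfl fun b _ => ?_).trans
      (sum_subset (range_subset_range.mpr (show N + 1 ≤ 9 * m by omega)) fun b _ hb => ?_)
    · rw [pow_add]; ring
    · rw [mem_range] at hb
      simp [Nat.choose_eq_zero_of_lt (show N < b by omega)]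
  simp_rw [h1]
  rw [sum_comm]
  simp_rw [← mul_sum]
  rw [sum_eq_add_of_mem m (5 * m) (mem_range.mpr (by omega)) (mem_range.mpr (by omega)) (by omega),
    sum_teich_pow_of_dvd (by omega) ⟨1, by omega⟩, sum_teich_pow_of_dvd (by omega) ⟨2, by omega⟩]
  · ring
  · rintro b hb ⟨hb1, hb2⟩
    rw [mem_range] at hb
    rw [sum_teich_pow_of_not_dvd, mul_zero]
    rintro ⟨l, hl⟩
    rw [show p - 1 = 4 * m by omega] at hl
    have hl1 : 0 < l := Nat.pos_of_ne_zero (by rintro rfl; omega)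
    have hl3 : l < 3 := by
      by_contra hl3
      have : 4 * m * 3 ≤ 4 * m * l := Nat.mul_le_mul_left _ (by omega)
      omega
    interval_cases l <;> omega

lemma sum_teich_mul_teich_mul_add_pow {m : ℕ} (hm : p = 4 * m + 1) {N : ℕ}
    (hN : N < 9 * m) :
    ∑ x : ZMod p, ∑ y : ZMod p,
        teich x ^ (3 * m) * teich y ^ (3 * m) * (1 + teich x + teich y) ^ N =
      ((p : ZMod (p ^ 2)) - 1) ^ 2 * ((N.choose m * ((N - m).choose m + (N - m).choose (5 * m)) +
        N.choose (5 * m) * ((N - 5 * m).choose m + (N - 5 * m).choose (5 * m)) : ℕ)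
          : ZMod (p ^ 2)) := by
  have h1 : ∀ x : ZMod p, ∑ y : ZMod p,
      teich x ^ (3 * m) * teich y ^ (3 * m) * (1 + teich x + teich y) ^ N =
      ((p : ZMod (p ^ 2)) - 1) *
        ((N.choose m : ZMod (p ^ 2)) * (teich x ^ (3 * m) * (1 + teich x) ^ (N - m)) +
        (N.choose (5 * m) : ZMod (p ^ 2)) *
          (teich x ^ (3 * m) * (1 + teich x) ^ (N - 5 * m))) := by
    intro x
    simp_rw [mul_assoc]
    rw [← mul_sum, sum_teich_mul_add_pow hm _ hN]
    ring
  simp_rw [h1]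
  rw [← mul_sum, sum_add_distrib, ← mul_sum, ← mul_sum,
    sum_teich_mul_add_pow hm _ (by omega), sum_teich_mul_add_pow hm _ (by omega)]
  push_cast
  simp only [one_pow]
  ring

lemma pow_three_mul_prime {m : ℕ} (hm : p = 4 * m + 1) (hm0 : m ≠ 0) (s : ZMod (p ^ 2)) :
    s ^ (3 * m * p) = s ^ (3 * m) +
      3 * (m : ZMod (p ^ 2)) * (s ^ (7 * m) - s ^ (3 * m)) := by
  by_cases hs : resid p s = 0
  · obtain ⟨w, hw⟩ := exists_of_resid_eq (x := s) (y := 0) (by rw [hs, map_zero])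
    have hz : ∀ k, 2 ≤ k → s ^ k = 0 := by
      intro k hk
      obtain ⟨l, rfl⟩ := Nat.exists_eq_add_of_le hk
      rw [pow_add, hw]
      linear_combination w ^ 2 * (0 + (p : ZMod (p ^ 2)) * w) ^ l *
        natCast_mul_self_eq_zero (p := p)
    have h2 : 2 ≤ 3 * m * p := by
      calc 2 ≤ 3 * m * 1 := by omega
        _ ≤ 3 * m * p := Nat.mul_le_mul_left _ hp.out.one_le
    rw [hz _ h2, hz _ (by omega), hz _ (by omega)]
    ring
  · have h1 : resid p (s ^ (4 * m)) = resid p 1 := by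
      rw [map_pow, show 4 * m = p - 1 by omega, ZMod.pow_card_sub_one_eq_one hs, map_one]
    obtain ⟨w, hw⟩ := exists_of_resid_eq h1
    have e : 3 * m * p = 3 * m + 4 * m * (3 * m) := by
      conv_lhs => rw [hm]
      ring
    have e7 : 7 * m = 3 * m + 4 * m := by ring
    rw [e, e7, pow_add, pow_mul s (4 * m), pow_add, hw, add_mul_pow, one_pow, one_pow]
    push_cast
    ring

lemma choose_seven_mul {m : ℕ} (hm : p = 4 * m + 1) :
    ((p : ZMod (p ^ 2)) + 3 * (m : ZMod (p ^ 2))) * ((7 * m).choose (2 * m) : ZMod (p ^ 2)) =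
      ((p : ZMod (p ^ 2)) + (m : ZMod (p ^ 2))) * ((3 * m).choose m : ZMod (p ^ 2)) := by
  have h1 : ((2 * m).factorial * (7 * m).choose (2 * m) : ℕ) =
      ∏ j ∈ range (2 * m), (p + m + j) := by
    rw [← Nat.descFactorial_eq_factorial_mul_choose, Nat.descFactorial_eq_prod_range,
      ← prod_range_reflect]
    refine prod_congr rfl fun j hj => ?_
    rw [mem_range] at hj
    omega
  have h2 : (2 * m).factorial * ((3 * m).choose m * m.factorial) = (3 * m).factorial := by
    have := Nat.choose_mul_factorial_mul_factorial (show m ≤ 3 * m by omega)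
    rw [show 3 * m - m = 2 * m by omega] at this
    rw [← this]; ring
  have h3 := factorial_mul_prod_range (p := p) m
  have h4 := prod_add_add m hm
  have hu := (isUnit_factorial (p := p) (show 2 * m < p by omega)).mul
    (isUnit_factorial (p := p) (show m < p by omega))
  have h1' := congrArg (Nat.cast : ℕ → ZMod (p ^ 2)) h1
  have h2' := congrArg (Nat.cast : ℕ → ZMod (p ^ 2)) h2
  have h5 : (∏ j ∈ range (2 * m), ((p : ZMod (p ^ 2)) + (m : ZMod (p ^ 2)) + (j : ZMod (p ^ 2)))) *
      ((p : ZMod (p ^ 2)) + 3 * (m : ZMod (p ^ 2))) =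
      (∏ j ∈ range (2 * m), ((p : ZMod (p ^ 2)) + (((m + j : ℕ) : ZMod (p ^ 2)) + 1))) *
        ((p : ZMod (p ^ 2)) + (m : ZMod (p ^ 2))) := by
    have e := prod_range_succ
      (fun j : ℕ => (p : ZMod (p ^ 2)) + (m : ZMod (p ^ 2)) + (j : ZMod (p ^ 2))) (2 * m)
    rw [prod_range_succ'] at e
    push_cast at e ⊢
    rw [show (p : ZMod (p ^ 2)) + 3 * (m : ZMod (p ^ 2)) = p + m + 2 * m by ring, ← e, add_zero]
    congr 1
    exact prod_congr rfl fun j _ => by ring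
  rw [h4] at h5
  push_cast at h1' h2' h3 h5
  refine hu.mul_left_cancel ?_
  linear_combination (m.factorial : ZMod (p ^ 2)) * (p + 3 * m) * h1' +
    (m.factorial : ZMod (p ^ 2)) * h5 + (p + m) * h3 - (p + m) * h2'

lemma sum_teich_triple {m : ℕ} (hm : p = 4 * m + 1) (hm0 : m ≠ 0) :
    ∑ x : ZMod p, ∑ y : ZMod p,
      teich x ^ (3 * m) * teich y ^ (3 * m) * teich (1 - x - y) ^ (3 * m) =
        (tripChoose m : ZMod (p ^ 2)) := by
  have h1 : ∀ x y : ZMod p,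
      teich (-x) ^ (3 * m) * teich (-y) ^ (3 * m) * teich (1 - -x - -y) ^ (3 * m) =
      (1 - 3 * (m : ZMod (p ^ 2))) *
        (teich x ^ (3 * m) * teich y ^ (3 * m) * (1 + teich x + teich y) ^ (3 * m)) +
      3 * (m : ZMod (p ^ 2)) *
        (teich x ^ (3 * m) * teich y ^ (3 * m) * (1 + teich x + teich y) ^ (7 * m)) := by
    intro x y
    have e : teich (1 - -x - -y) = (1 + teich x + teich y) ^ p := by
      rw [← teich_resid]
      simp only [map_add, map_one, resid_teich]
      congr 1
      ring
    have e2 : ((-1 : ZMod (p ^ 2)) ^ (3 * m)) ^ 2 = 1 := by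
      rw [← pow_mul, mul_comm, pow_mul]; norm_num
    rw [e, ← pow_mul, mul_comm p, pow_three_mul_prime hm hm0, teich_neg hm, teich_neg hm,
      neg_pow, neg_pow (teich y)]
    linear_combination (teich x ^ (3 * m) * teich y ^ (3 * m) *
      ((1 + teich x + teich y) ^ (3 * m) + 3 * (m : ZMod (p ^ 2)) *
        ((1 + teich x + teich y) ^ (7 * m) - (1 + teich x + teich y) ^ (3 * m)))) * e2
  rw [← Equiv.sum_comp (Equiv.neg (ZMod p))]
  have h2 : ∀ x : ZMod p, ∑ y : ZMod p, teich (Equiv.neg (ZMod p) x) ^ (3 * m) *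
      teich y ^ (3 * m) * teich (1 - Equiv.neg (ZMod p) x - y) ^ (3 * m) =
      (1 - 3 * (m : ZMod (p ^ 2))) * ∑ y : ZMod p,
        (teich x ^ (3 * m) * teich y ^ (3 * m) * (1 + teich x + teich y) ^ (3 * m)) +
      3 * (m : ZMod (p ^ 2)) * ∑ y : ZMod p,
        (teich x ^ (3 * m) * teich y ^ (3 * m) * (1 + teich x + teich y) ^ (7 * m)) := by
    intro x
    rw [← Equiv.sum_comp (Equiv.neg (ZMod p)), mul_sum, mul_sum, ← sum_add_distrib]
    exact sum_congr rfl fun y _ => h1 x y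
  simp_rw [h2]
  rw [sum_add_distrib, ← mul_sum, ← mul_sum,
    sum_teich_mul_teich_mul_add_pow hm (by omega),
    sum_teich_mul_teich_mul_add_pow hm (by omega)]
  have c3 : (3 * m).choose m * ((3 * m - m).choose m + (3 * m - m).choose (5 * m)) +
      (3 * m).choose (5 * m) * ((3 * m - 5 * m).choose m + (3 * m - 5 * m).choose (5 * m)) =
      tripChoose m := by
    rw [show 3 * m - m = 2 * m by omega,
      Nat.choose_eq_zero_of_lt (show 2 * m < 5 * m by omega),
      Nat.choose_eq_zero_of_lt (show 3 * m < 5 * m by omega), tripChoose]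
    ring
  have c7 : (7 * m).choose m * ((7 * m - m).choose m + (7 * m - m).choose (5 * m)) +
      (7 * m).choose (5 * m) * ((7 * m - 5 * m).choose m + (7 * m - 5 * m).choose (5 * m)) =
      3 * ((7 * m).choose (2 * m) * (2 * m).choose m) := by
    have a1 := Nat.choose_mul (n := 7 * m) (k := 2 * m) (s := m) (by omega)
    rw [show 7 * m - m = 6 * m by omega, show 2 * m - m = m by omega] at a1
    rw [show 7 * m - m = 6 * m by omega, show 7 * m - 5 * m = 2 * m by omega,
      Nat.choose_eq_zero_of_lt (show 2 * m < 5 * m by omega), a1,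
      Nat.choose_symm_of_eq_add (show 6 * m = 5 * m + m by ring),
      Nat.choose_symm_of_eq_add (show 7 * m = 5 * m + 2 * m by ring), add_zero, a1]
    ring
  rw [c3, c7]
  have hu : IsUnit ((p : ZMod (p ^ 2)) + 3 * (m : ZMod (p ^ 2))) := by
    have := isUnit_natCast (p := p) (k := 3 * m) (by omega) (by omega)
    refine isUnit_of_resid_ne_zero ?_
    rw [map_add, map_natCast, CharP.cast_eq_zero, zero_add, map_mul, map_ofNat, map_natCast]
    exact_mod_cast natCast_zmod_ne_zero (p := p) (k := 3 * m) (by omega) (by omega)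
  have h7 := choose_seven_mul hm
  have hp2 := natCast_mul_self_eq_zero (p := p)
  have hpm := natCast_self_eq hm
  refine hu.mul_left_cancel ?_
  rw [tripChoose]
  push_cast
  generalize ((7 * m).choose (2 * m) : ZMod (p ^ 2)) = c at *
  generalize ((3 * m).choose m : ZMod (p ^ 2)) = b at *
  generalize ((2 * m).choose m : ZMod (p ^ 2)) = e at *
  generalize (p : ZMod (p ^ 2)) = q at *
  generalize (m : ZMod (p ^ 2)) = M at *
  linear_combination ((q - 1) ^ 2 * 9 * M * e) * h7 +
    b * e * (q + 3 * M + 6 * M * q - 2 - 12 * M) * hp2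

end Teichmuller

section QuarticCharacter

variable {p : ℕ} [hp : Fact p.Prime]

/-- The unit `i` of `ℤ[i]`. -/
def gaussI : GaussianIntˣ := ⟨⟨0, 1⟩, ⟨0, -1⟩, by ext <;> simp, by ext <;> simp⟩

lemma gaussI_sq : gaussI ^ 2 = -1 := by
  ext <;> simp [gaussI, pow_two]

lemma gaussI_pow_four : gaussI ^ 4 = 1 := by
  rw [show 4 = 2 * 2 by rfl, pow_mul, gaussI_sq]; simp

lemma exists_quartic_mulChar {m : ℕ} (hm : p = 4 * m + 1) (hm0 : m ≠ 0) :
    ∃ (φ : GaussianInt →+* ZMod (p ^ 2)) (χ : MulChar (ZMod p) GaussianInt),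
      χ ^ 4 = 1 ∧ χ ^ 2 ≠ 1 ∧ ∀ x, φ (χ x) = teich x ^ (3 * m) := by
  obtain ⟨g, hg⟩ := IsCyclic.exists_generator (α := (ZMod p)ˣ)
  have hcard : Fintype.card (ZMod p)ˣ = 4 * m := by rw [ZMod.card_units p]; omega
  have hord : orderOf g = 4 * m := by
    rw [orderOf_eq_card_of_forall_mem_zpowers hg, Nat.card_eq_fintype_card, hcard]
  have hg2 : (g : ZMod p) ^ (2 * m) = -1 := by
    have h1 : ((g : ZMod p) ^ (2 * m)) ^ 2 = 1 := by
      rw [← pow_mul, show 2 * m * 2 = 4 * m by ring, ← hord]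
      rw [← Units.val_pow_eq_pow_val, pow_orderOf_eq_one, Units.val_one]
    refine (sq_eq_one_iff.mp h1).resolve_left fun h => ?_
    have : orderOf g ∣ 2 * m := orderOf_dvd_of_pow_eq_one (Units.ext (by simpa using h))
    rw [hord] at this
    have := Nat.le_of_dvd (by omega) this
    omega
  have hI : teich (g : ZMod p) ^ (3 * m) * teich (g : ZMod p) ^ (3 * m) =
      ((-1 : ℤ) : ZMod (p ^ 2)) := by
    have h1 : teich (g : ZMod p) ^ (2 * m) = -1 := by
      rw [← teich_pow, hg2, teich_neg hm, teich_one]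
    rw [← pow_add, show 3 * m + 3 * m = 2 * m * 3 by ring, pow_mul, h1]
    push_cast
    ring
  have hζ : gaussI ∈ rootsOfUnity (Fintype.card (ZMod p)ˣ) GaussianInt := by
    rw [mem_rootsOfUnity, hcard, pow_mul, gaussI_pow_four, one_pow]
  have hval : ∀ k : ℕ, MulChar.ofRootOfUnity hζ hg ((g ^ k : (ZMod p)ˣ) : ZMod p) =
      ((gaussI : GaussianInt)) ^ k := by
    intro k
    rw [Units.val_pow_eq_pow_val, map_pow, MulChar.ofRootOfUnity_spec]
  refine ⟨Zsqrtd.lift ⟨teich (g : ZMod p) ^ (3 * m), hI⟩, MulChar.ofRootOfUnity hζ hg, ?_, ?_, ?_⟩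
  · refine MulChar.ext fun a => ?_
    obtain ⟨k, rfl⟩ := mem_powers_iff_mem_zpowers.mpr (hg a)
    simp only
    rw [MulChar.pow_apply_coe, hval, MulChar.one_apply_coe, ← pow_mul, mul_comm, pow_mul]
    have := congrArg Units.val gaussI_pow_four
    push_cast at this
    rw [this, one_pow]
  · intro h
    have h1 := congrArg (fun χ : MulChar (ZMod p) GaussianInt => χ (g : ZMod p)) h
    simp only [MulChar.pow_apply_coe, MulChar.one_apply_coe, MulChar.ofRootOfUnity_spec] at h1
    have := congrArg Units.val gaussI_sq
    push_cast at this
    rw [this] at h1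
    have := congrArg Zsqrtd.re h1
    simp at this
  · intro x
    by_cases hx : x = 0
    · rw [hx, MulChar.map_zero, map_zero, teich_zero, zero_pow (by omega)]
    · obtain ⟨k, hk⟩ := mem_powers_iff_mem_zpowers.mpr (hg (Units.mk0 x hx))
      simp only at hk
      have hx' : x = ((g ^ k : (ZMod p)ˣ) : ZMod p) := by rw [hk]; rfl
      have hi : Zsqrtd.lift ⟨teich (g : ZMod p) ^ (3 * m), hI⟩ (gaussI : GaussianInt) =
          teich (g : ZMod p) ^ (3 * m) := by
        simp [Zsqrtd.lift, gaussI]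
      rw [hx', hval, map_pow, hi, Units.val_pow_eq_pow_val, teich_pow, ← pow_mul, ← pow_mul,
        mul_comm k]

end QuarticCharacter

section Rotation

lemma three_dvd_sum_of_rotation {α A : Type*} [DecidableEq α] [CommRing A] {σ : α → α}
    (hσ : ∀ a, σ (σ (σ a)) = a) {f : α → A} (hf : ∀ a, f (σ a) = f a) (s : Finset α)
    (hs : ∀ a ∈ s, σ a ∈ s) (hs' : ∀ a ∈ s, σ a ≠ a) : (3 : A) ∣ ∑ a ∈ s, f a := by
  induction s using Finset.strongInduction with
  | H s ih =>
    rcases s.eq_empty_or_nonempty with rfl | ⟨a, ha⟩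
    · simp
    · have h1 : σ a ≠ a := hs' a ha
      have h2 : σ (σ a) ≠ σ a := hs' _ (hs a ha)
      have h3 : σ (σ a) ≠ a := fun h => h1 (by rw [← congrArg σ h, hσ])
      have hsub : ({a, σ a, σ (σ a)} : Finset α) ⊆ s := by
        simp [insert_subset_iff, ha, hs a ha, hs _ (hs a ha)]
      rw [← sum_sdiff hsub]
      refine dvd_add (ih _ (sdiff_ssubset hsub ⟨a, by simp⟩) ?_ ?_) ⟨f a, ?_⟩
      · intro b hb
        simp only [mem_sdiff, mem_insert, mem_singleton, not_or] at hb ⊢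
        refine ⟨hs b hb.1, fun h => hb.2.2.2 ?_, fun h => hb.2.1 ?_, fun h => hb.2.2.1 ?_⟩
        · rw [← h, hσ]
        · rw [← hσ b, h, hσ]
        · rw [← hσ b, h, hσ]
      · exact fun b hb => hs' b (mem_sdiff.mp hb).1
      · rw [sum_insert (by simp [h1.symm, h3.symm]), sum_insert (by simp [h2.symm]),
          sum_singleton, hf (σ a), hf a]
        ring

end Rotation

section TripleSum

variable {F R : Type*} [Field F] [Fintype F] [CommRing R]

/-- The generalized Jacobi sum `∑ χ(x) χ(y) χ(z)` over `x + y + z = 1`. -/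
def tripSum (χ : MulChar F R) : R := ∑ x : F, ∑ y : F, χ x * χ y * χ (1 - x - y)

lemma sum_mulChar_mul_sub [IsDomain R] {χ : MulChar F R} (hχ : χ ^ 2 ≠ 1) (s : F) :
    ∑ x : F, χ x * χ (s - x) = (χ ^ 2) s * jacobiSum χ χ := by
  classical
  rw [MulChar.pow_apply' χ two_ne_zero]
  by_cases hs : s = 0
  · have h : ∀ x : F, χ x * χ (s - x) = χ (-1) * (χ ^ 2) x := by
      intro x
      rw [hs, MulChar.pow_apply' χ two_ne_zero, zero_sub, ← neg_one_mul x, map_mul]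
      ring
    simp_rw [h]
    rw [← mul_sum, MulChar.sum_eq_zero_of_ne_one hχ, hs, MulChar.map_zero]
    ring
  · rw [jacobiSum, mul_sum, ← Equiv.sum_comp (Equiv.mulLeft₀ s hs)]
    refine sum_congr rfl fun x _ => ?_
    rw [show Equiv.mulLeft₀ s hs x = s * x from rfl, show s - s * x = s * (1 - x) by ring, map_mul, map_mul]
    ring

lemma tripSum_eq_mul_jacobiSum [IsDomain R] {χ : MulChar F R} (hχ : χ ^ 2 ≠ 1) :
    tripSum χ = jacobiSum χ χ * jacobiSum (χ ^ 2) χ := by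
  have h : ∀ x : F, ∑ y : F, χ x * χ y * χ (1 - x - y) =
      ∑ s : F, χ x * χ (s - x) * χ (1 - s) := by
    intro x
    rw [← Equiv.sum_comp (Equiv.subRight x)]
    refine sum_congr rfl fun y _ => ?_
    rw [Equiv.subRight_apply, sub_sub_sub_cancel_right]
  rw [tripSum]
  simp_rw [h]
  rw [sum_comm, jacobiSum.eq_1 (χ ^ 2), mul_sum]
  refine sum_congr rfl fun s _ => ?_
  rw [← sum_mul, sum_mulChar_mul_sub hχ]
  ring

lemma three_dvd_tripSum_sub [DecidableEq F] (h3 : (3 : F) ≠ 0) {χ : MulChar F R} (hχ : χ ^ 4 = 1) :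
    (3 : R) ∣ tripSum χ - χ 3 := by
  have hfix : χ (1 / 3) * χ (1 / 3) * χ (1 - 1 / 3 - 1 / 3) = χ 3 := by
    have h4 : ∀ a : F, a ≠ 0 → χ a ^ 4 = 1 := by
      intro a ha
      rw [← MulChar.pow_apply' χ four_ne_zero, hχ, MulChar.one_apply (Ne.isUnit ha)]
    have h1 : χ 3 * χ (1 / 3) = 1 := by
      rw [← map_mul, mul_one_div_cancel h3, map_one]
    rw [show (1 : F) - 1 / 3 - 1 / 3 = 1 / 3 by field_simp; norm_num]
    linear_combination χ 3 * h4 (1 / 3) (one_div_ne_zero h3) - χ (1 / 3) ^ 3 * h1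
  have h := three_dvd_sum_of_rotation (σ := fun a : F × F => (a.2, 1 - a.1 - a.2))
    (f := fun a : F × F => χ a.1 * χ a.2 * χ (1 - a.1 - a.2))
    (fun a => by ext <;> simp; ring)
    (fun a => by
      simp only
      rw [show 1 - a.2 - (1 - a.1 - a.2) = a.1 by ring]
      ring) (univ.erase (1 / 3, 1 / 3))
    (fun a ha => ?_) (fun a ha => ?_)
  · rw [tripSum, ← Fintype.sum_prod_type', ← sum_erase_add _ _ (mem_univ ((1 / 3, 1 / 3) : F × F)),
      hfix, add_sub_cancel_right]
    exact h
  · simp only [mem_erase, mem_univ, and_true, ne_eq] at ha ⊢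
    intro h
    apply ha
    obtain ⟨h1, h2⟩ := Prod.ext_iff.mp h
    simp only at h1 h2
    ext
    · simp only
      have : a.1 = 1 - a.2 - 1 / 3 := by rw [← h2]; ring
      rw [this, h1]
      field_simp
      norm_num
    · exact h1
  · simp only [mem_erase, mem_univ, and_true, ne_eq] at ha ⊢
    intro h
    apply ha
    obtain ⟨h1, h2⟩ := Prod.ext_iff.mp h
    simp only at h1 h2
    have h5 : a.1 = 1 / 3 := by
      rw [eq_div_iff h3]
      linear_combination -h2 - 2 * h1
    ext
    · exact h5
    · exact h1.trans h5

end TripleSum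

section GaussianNorm

variable {p : ℕ} [hp : Fact p.Prime]

lemma norm_jacobiSum {χ ψ : MulChar (ZMod p) GaussianInt} (hχ : χ ≠ 1) (hψ : ψ ≠ 1)
    (hχψ : χ * ψ ≠ 1) : (jacobiSum χ ψ).norm = p := by
  have hinj := GaussianInt.toComplex_injective
  have hne : ∀ η : MulChar (ZMod p) GaussianInt, η ≠ 1 →
      η.ringHomComp GaussianInt.toComplex ≠ 1 := fun η h =>
    (MulChar.ringHomComp_ne_one_iff hinj).mpr h
  have h1 := jacobiSum_mul_jacobiSum_inv (F := ZMod p) (F' := ℂ)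
    (by rw [ringChar.eq_zero, ZMod.ringChar_zmod_n]; exact hp.out.ne_zero.symm)
    (hne χ hχ) (hne ψ hψ) (by
      rw [← MulChar.ringHomComp_mul]
      exact hne _ hχψ)
  have h2 : jacobiSum (χ.ringHomComp GaussianInt.toComplex)⁻¹
      (ψ.ringHomComp GaussianInt.toComplex)⁻¹ =
      (starRingEnd ℂ) (jacobiSum (χ.ringHomComp GaussianInt.toComplex)
        (ψ.ringHomComp GaussianInt.toComplex)) := by
    rw [jacobiSum, jacobiSum, map_sum]
    refine sum_congr rfl fun x _ => ?_
    rw [map_mul, ← MulChar.star_apply', ← MulChar.star_apply']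
    rfl
  rw [h2, Complex.mul_conj, jacobiSum_ringHomComp, ← GaussianInt.intCast_complex_norm,
    ZMod.card] at h1
  exact_mod_cast h1

lemma norm_tripSum {χ : MulChar (ZMod p) GaussianInt} (hχ4 : χ ^ 4 = 1) (hχ2 : χ ^ 2 ≠ 1) :
    (tripSum χ).norm = (p : ℤ) ^ 2 := by
  have h1 : χ ≠ 1 := by
    rintro rfl
    exact hχ2 (one_pow 2)
  have h3 : χ ^ 2 * χ ≠ 1 := by
    intro h
    refine h1 ?_
    calc χ = (χ ^ 2 * χ) * χ := by rw [h, one_mul]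
      _ = χ ^ 4 := by rw [← pow_succ, ← pow_succ]
      _ = 1 := hχ4
  rw [tripSum_eq_mul_jacobiSum hχ2, Zsqrtd.norm_mul,
    norm_jacobiSum h1 h1 (by rwa [← pow_two]), norm_jacobiSum hχ2 h1 h3, pow_two]

end GaussianNorm

section SumOfTwoSquares

lemma eq_of_sq_dvd_mul_sub_mul {p A B A' B' : ℤ} (hp0 : p ≠ 0) (h : A ^ 2 + B ^ 2 = p ^ 2)
    (h' : A' ^ 2 + B' ^ 2 = p ^ 2) (hA : 3 ∣ A - 1) (hB : 3 ∣ B) (hA' : 3 ∣ A' - 1)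
    (hdvd : p ^ 2 ∣ B * A' - A * B') : A = A' := by
  obtain ⟨t, ht⟩ := hdvd
  obtain ⟨a, ha⟩ := hA
  obtain ⟨b, rfl⟩ := hB
  obtain ⟨a', ha'⟩ := hA'
  have hp2 : 0 < p ^ 2 := by positivity
  have hN : (A * A' + 3 * b * B') ^ 2 = p ^ 4 * (1 - t ^ 2) := by
    have : (A * A' + 3 * b * B') ^ 2 + (3 * b * A' - A * B') ^ 2 =
      (A ^ 2 + (3 * b) ^ 2) * (A' ^ 2 + B' ^ 2) := by ring
    rw [h, h', ht] at this
    linear_combination this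
  have hA1 : A = 3 * a + 1 := by linarith
  have hA1' : A' = 3 * a' + 1 := by linarith
  have hN1 : A * A' + 3 * b * B' = 3 * (3 * a * a' + a + a' + b * B') + 1 := by
    rw [hA1, hA1']; ring
  have ht0 : t = 0 := by
    by_contra ht0
    have h1 : 1 ≤ t ^ 2 := by
      have := sq_pos_of_ne_zero ht0
      linarith
    have h2 : (A * A' + 3 * b * B') ^ 2 = 0 := by
      refine le_antisymm ?_ (sq_nonneg _)
      rw [hN]
      have : 0 ≤ p ^ 4 := by positivity
      nlinarith
    rw [pow_eq_zero_iff two_ne_zero] at h2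
    omega
  rw [ht0] at hN ht
  have hN2 : A * A' + 3 * b * B' = p ^ 2 := by
    have h1 : (A * A' + 3 * b * B') ^ 2 = (p ^ 2) ^ 2 := by linear_combination hN
    rcases sq_eq_sq_iff_eq_or_eq_neg.mp h1 with h2 | h2
    · exact h2
    · exfalso
      have h3 : p ^ 2 = 3 * (3 * a ^ 2 + 2 * a + 3 * b ^ 2) + 1 := by
        rw [← h, hA1]; ring
      omega
  refine mul_right_cancel₀ hp2.ne' ?_
  linear_combination -A * h' + A' * hN2 - B' * ht

lemma eq_of_sq_add_sq_eq_sq {p A B A' B' : ℤ} (hp : Prime p) (hp2 : ¬ p ∣ 2)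
    (h : A ^ 2 + B ^ 2 = p ^ 2) (h' : A' ^ 2 + B' ^ 2 = p ^ 2)
    (hA : 3 ∣ A - 1) (hB : 3 ∣ B) (hA' : 3 ∣ A' - 1) (hpA : ¬ p ∣ A) (hpA' : ¬ p ∣ A') :
    A = A' := by
  have hmul : p ^ 2 ∣ (B * A' - A * B') * (B * A' - A * (-B')) :=
    ⟨A' ^ 2 - A ^ 2, by linear_combination A' ^ 2 * h - A ^ 2 * h'⟩
  have hnot : ¬ (p ∣ B * A' - A * B' ∧ p ∣ B * A' - A * (-B')) := by
    rintro ⟨h1, h2⟩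
    have h3 : p ∣ 2 * (A * B') := by
      have := dvd_sub h2 h1
      rwa [show B * A' - A * (-B') - (B * A' - A * B') = 2 * (A * B') by ring] at this
    have h4 := ((hp.dvd_or_dvd ((hp.dvd_or_dvd h3).resolve_left hp2)).resolve_left hpA)
    refine hpA' (hp.dvd_of_dvd_pow (n := 2) ?_)
    rw [show A' ^ 2 = p * p - B' * B' by linear_combination h']
    exact dvd_sub (dvd_mul_left _ _) (h4.mul_left _)
  rcases not_and_or.mp hnot with h1 | h1
  · refine eq_of_sq_dvd_mul_sub_mul (B := B) (B' := -B') hp.ne_zero h (by rw [neg_sq, h']) hA hB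
      hA' ?_
    exact (IsCoprime.pow_left ((Prime.coprime_iff_not_dvd hp).mpr h1)).dvd_of_dvd_mul_left hmul
  · refine eq_of_sq_dvd_mul_sub_mul hp.ne_zero h h' hA hB hA' ?_
    exact (IsCoprime.pow_left ((Prime.coprime_iff_not_dvd hp).mpr h1)).dvd_of_dvd_mul_right hmul

end SumOfTwoSquares

section Evaluation

variable {p : ℕ} [hp : Fact p.Prime]

lemma isUnit_tripChoose {m : ℕ} (hm : p = 4 * m + 1) :
    IsUnit (tripChoose m : ZMod (p ^ 2)) := by
  have h := isUnit_factorial (p := p) (k := 3 * m) (by omega)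
  rw [← tripChoose_mul, Nat.cast_mul] at h
  exact isUnit_of_mul_isUnit_left h

lemma exists_sq_add_sq_eq_sq {m : ℕ} (hm : p = 4 * m + 1) (hm0 : m ≠ 0) :
    ∃ A B : ℤ, A ^ 2 + B ^ 2 = (p : ℤ) ^ 2 ∧ 3 ∣ A - 1 ∧ 3 ∣ B ∧ ¬ (p : ℤ) ∣ A ∧
      ∀ S : ZMod (p ^ 2), S * 3 ^ (3 * m * p) = (tripChoose m : ZMod (p ^ 2)) →
        S = ((2 * A : ℤ) : ZMod (p ^ 2)) := by
  obtain ⟨φ, χ, hχ4, hχ2, hφ⟩ := exists_quartic_mulChar hm hm0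
  have h3 : (3 : ZMod p) ≠ 0 := by
    exact_mod_cast natCast_zmod_ne_zero (p := p) (k := 3) (by omega) (by omega)
  have hφY : φ (tripSum χ) = (tripChoose m : ZMod (p ^ 2)) := by
    rw [← sum_teich_triple hm hm0, tripSum]
    simp only [map_sum, map_mul, hφ]
  have hφu : φ (χ 3) = 3 ^ (3 * m * p) := by
    rw [hφ, ← map_ofNat (resid p) 3, teich_resid, ← pow_mul, mul_comm p]
  have hu4 : χ 3 ^ 4 = 1 := by
    rw [← MulChar.pow_apply' χ four_ne_zero, hχ4, MulChar.one_apply (Ne.isUnit h3)]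
  have hnu : (χ 3).norm = 1 := by
    have h1 := congrArg Zsqrtd.normMonoidHom hu4
    rw [map_pow, map_one] at h1
    exact (pow_eq_one_iff_of_nonneg (GaussianInt.norm_nonneg _) four_ne_zero).mp h1
  have hus : χ 3 * star (χ 3) = 1 := by
    rw [← Zsqrtd.norm_eq_mul_conj, hnu]; rfl
  obtain ⟨w, hw⟩ := three_dvd_tripSum_sub h3 hχ4
  have hZ : tripSum χ * star (χ 3) = 1 + 3 * (w * star (χ 3)) := by
    linear_combination star (χ 3) * hw + hus
  have hZn : (tripSum χ * star (χ 3)).norm = (p : ℤ) ^ 2 := by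
    rw [Zsqrtd.norm_mul, norm_tripSum hχ4 hχ2, Zsqrtd.norm_conj, hnu, mul_one]
  have hφZ : φ (tripSum χ * star (χ 3)) * 3 ^ (3 * m * p) = (tripChoose m : ZMod (p ^ 2)) := by
    rw [← hφu, ← map_mul, mul_assoc, mul_comm (star (χ 3)), hus, mul_one, hφY]
  generalize w * star (χ 3) = v at hZ
  generalize tripSum χ * star (χ 3) = Z at hZ hZn hφZ
  have hunit : IsUnit (φ Z) := isUnit_of_mul_isUnit_left (hφZ ▸ isUnit_tripChoose hm)
  have hstar : φ (star Z) = 0 := by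
    refine hunit.mul_left_cancel ?_
    rw [← map_mul, ← Zsqrtd.norm_eq_mul_conj, hZn, mul_zero, map_intCast]
    push_cast
    rw [pow_two (p : ZMod (p ^ 2)), natCast_mul_self_eq_zero]
  have hre : φ Z = ((2 * Z.re : ℤ) : ZMod (p ^ 2)) := by
    rw [← add_zero (φ Z), ← hstar, ← map_add, ← map_intCast φ]
    congr 1
    ext
    · simp; ring
    · simp
  refine ⟨Z.re, Z.im, ?_, ⟨v.re, ?_⟩, ⟨v.im, ?_⟩, ?_, ?_⟩
  · rw [← hZn, Zsqrtd.norm]; ring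
  · rw [hZ]; simp
  · rw [hZ]; simp
  · rintro ⟨c, hc⟩
    have h1 := hunit.map (resid p)
    rw [hre, hc, map_intCast] at h1
    push_cast at h1
    rw [CharP.cast_eq_zero] at h1
    simp at h1
  · intro S hS
    rw [← hre]
    have h3u : IsUnit ((3 : ZMod (p ^ 2)) ^ (3 * m * p)) :=
      isUnit_of_mul_isUnit_right (hφZ ▸ isUnit_tripChoose hm)
    exact h3u.mul_right_cancel (hS.trans hφZ.symm)

end Evaluation

section PIntegers

lemma isPInt_of_mul_eq {p : ℕ} {D N : ℤ} {x : ℚ} (hD : ¬ (p : ℤ) ∣ D)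
    (h : (D : ℚ) * x = N) : isPInt p x := by
  have hD0 : (D : ℚ) ≠ 0 := by
    rintro h0
    refine hD ?_
    rw [Int.cast_eq_zero.mp h0]
    exact dvd_zero _
  have hx : x = (N : ℚ) / (D : ℚ) := by rw [eq_div_iff hD0, mul_comm, h]
  intro hdvd
  refine hD (dvd_trans (Int.natCast_dvd_natCast.mpr hdvd) ?_)
  rw [hx, ← Rat.divInt_eq_div]
  exact Rat.den_dvd N D

lemma pCong_of_pCong {p k : ℕ} {u v w : ℚ} (hp : p.Prime) (hu : pCong p k u w)
    (hv : pCong p k v w) : pCong p k u v := by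
  rw [pCong, show (u - v) / (p : ℚ) ^ k = (u - w) / (p : ℚ) ^ k - (v - w) / (p : ℚ) ^ k by ring]
  intro h
  exact (hp.dvd_mul.mp (h.trans (Rat.sub_den_dvd _ _))).elim hu hv

lemma pCong_sum_div_pow {p k : ℕ} (hp : p.Prime) {q : ℤ} (hq : ¬ (p : ℤ) ∣ q)
    {c : ZMod (p ^ k)} (hc : (q : ZMod (p ^ k)) * c = 1) (f : ℕ → ℤ) (N : ℕ) (T : ℤ)
    (h : ∑ n ∈ range N, (f n : ZMod (p ^ k)) * c ^ n = (T : ZMod (p ^ k))) :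
    pCong p k (∑ n ∈ range N, (f n : ℚ) / (q : ℚ) ^ n) (T : ℚ) := by
  have hq0 : (q : ℚ) ≠ 0 := by
    rintro h0
    refine hq ?_
    rw [Int.cast_eq_zero.mp h0]
    exact dvd_zero _
  have hp0 : (p : ℚ) ≠ 0 := Nat.cast_ne_zero.mpr hp.ne_zero
  have h1 : (((∑ n ∈ range N, f n * q ^ (N - n)) - q ^ N * T : ℤ) : ZMod (p ^ k)) = 0 := by
    push_cast
    rw [← h, mul_sum, sub_eq_zero]
    refine sum_congr rfl fun n hn => ?_
    obtain ⟨l, rfl⟩ := Nat.exists_eq_add_of_le (mem_range.mp hn).le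
    have h2 : (q : ZMod (p ^ k)) ^ n * c ^ n = 1 := by rw [← mul_pow, hc, one_pow]
    rw [Nat.add_sub_cancel_left, pow_add]
    linear_combination -(f n : ZMod (p ^ k)) * (q : ZMod (p ^ k)) ^ l * h2
  obtain ⟨t, ht⟩ := (ZMod.intCast_zmod_eq_zero_iff_dvd _ _).mp h1
  refine isPInt_of_mul_eq (D := q ^ N) (N := t)
    (fun hd => hq ((Nat.prime_iff_prime_int.mp hp).dvd_of_dvd_pow hd)) ?_
  have h3 : (q : ℚ) ^ N * ∑ n ∈ range N, (f n : ℚ) / (q : ℚ) ^ n =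
      ((∑ n ∈ range N, f n * q ^ (N - n) : ℤ) : ℚ) := by
    push_cast
    rw [mul_sum]
    refine sum_congr rfl fun n hn => ?_
    obtain ⟨l, rfl⟩ := Nat.exists_eq_add_of_le (mem_range.mp hn).le
    rw [Nat.add_sub_cancel_left, pow_add]
    field_simp
  have ht' := congrArg (Int.cast : ℤ → ℚ) ht
  push_cast at ht' h3 ⊢
  rw [← h3] at ht'
  field_simp
  linear_combination ht'

end PIntegers

section AlmkvistZudilin

variable {p : ℕ} [hp : Fact p.Prime]

lemma pCong_sum_az_of_sq_add_sq {m : ℕ} (hm : p = 4 * m + 1) {A B : ℤ}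
    (h : A ^ 2 + B ^ 2 = (p : ℤ) ^ 2) (hA : 3 ∣ A - 1) (hB : 3 ∣ B) (hpA : ¬ (p : ℤ) ∣ A) :
    pCong p 2 (∑ n ∈ range p, (az n : ℚ) / (-3) ^ n) (2 * A) ∧
      pCong p 2 (∑ n ∈ range p, (az n : ℚ) / (-27) ^ n) (2 * A) := by
  have hm0 : m ≠ 0 := by
    rintro rfl
    exact hp.out.one_lt.ne' hm
  have hp3 : ¬ (p : ℤ) ∣ -3 := by
    rw [Int.dvd_neg]
    intro h3
    have := (Nat.prime_dvd_prime_iff_eq hp.out Nat.prime_three).mp (Int.natCast_dvd_natCast.mp h3)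
    omega
  have hpZ : Prime (p : ℤ) := Nat.prime_iff_prime_int.mp hp.out
  have hp27 : ¬ (p : ℤ) ∣ -27 := fun h27 =>
    hp3 (hpZ.dvd_of_dvd_pow (n := 3) (by rwa [show (-3 : ℤ) ^ 3 = -27 by rfl]))
  have hp2 : ¬ (p : ℤ) ∣ 2 := by
    intro h2
    have := (Nat.prime_dvd_prime_iff_eq hp.out Nat.prime_two).mp (Int.natCast_dvd_natCast.mp h2)
    omega
  obtain ⟨A', B', h', hA', hB', hpA', hS⟩ := exists_sq_add_sq_eq_sq hm hm0
  obtain rfl := eq_of_sq_add_sq_eq_sq hpZ hp2 h h' hA hB hA' hpA hpA'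
  have h3u : IsUnit (-3 : ZMod (p ^ 2)) := by
    have := isUnit_natCast (p := p) (k := 3) (by omega) (by omega)
    exact_mod_cast this.neg
  obtain ⟨c, hc⟩ := h3u.exists_right_inv
  have hd : (-27) * c ^ 3 = 1 := by
    rw [show (-27) * c ^ 3 = ((-3) * c) ^ 3 by ring, hc, one_pow]
  have e1 := pCong_sum_div_pow hp.out hp3 (k := 2) (c := c) (by push_cast; exact hc) az p (2 * A) (by
    rw [sum_az_mul_pow p hc]
    exact hS _ (sum_mul_three_pow hm hm0 (fun k hk => quadChoose_mul_choose_add hk)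
      (quadChoose_mul_choose_add_self hm) hd))
  have e2 := pCong_sum_div_pow hp.out hp27 (k := 2) (c := c ^ 3) (by push_cast; exact hd) az p
    (2 * A) (by
      rw [sum_az_mul_pow' p hd]
      exact hS _ (sum_mul_three_pow hm hm0 (fun k hk => quadChoose_mul_choose_add_three_mul hk)
        (quadChoose_mul_choose_add_three_mul_self hm) hd))
  push_cast at e1 e2
  exact ⟨e1, e2⟩

omit hp in
lemma not_dvd_of_eq_sq_add_nine_mul_sq (hp : p.Prime) {a x y : ℤ}
    (ha : ¬ (p : ℤ) ∣ a) (h : a * p = x ^ 2 + 9 * y ^ 2) : ¬ (p : ℤ) ∣ x := by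
  have hpZ : Prime (p : ℤ) := Nat.prime_iff_prime_int.mp hp
  rintro ⟨t, rfl⟩
  have h9 : (p : ℤ) ∣ (3 * y) ^ 2 := ⟨a - p * t ^ 2, by linear_combination -h⟩
  obtain ⟨s, hs⟩ := hpZ.dvd_of_dvd_pow h9
  refine ha ⟨t ^ 2 + s ^ 2, mul_right_cancel₀ hpZ.ne_zero ?_⟩
  linear_combination h + (3 * y + p * s) * hs

end AlmkvistZudilin

end Preliminaries

theorem stmt18 (p : ℕ) (hp : p.Prime) (hp4 : p % 4 = 1) :
    (p % 12 = 1 → ∀ x y : ℤ, (p : ℤ) = x ^ 2 + 9 * y ^ 2 →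
      pCong p 2 (∑ n ∈ Finset.range p, (az n : ℚ) / (-3) ^ n)
        (∑ n ∈ Finset.range p, (az n : ℚ) / (-27) ^ n) ∧
      pCong p 2 (∑ n ∈ Finset.range p, (az n : ℚ) / (-27) ^ n)
        (4 * (x : ℚ) ^ 2 - 2 * (p : ℚ))) ∧
    (p % 12 = 5 → ∀ x y : ℤ, 2 * (p : ℤ) = x ^ 2 + 9 * y ^ 2 →
      pCong p 2 (∑ n ∈ Finset.range p, (az n : ℚ) / (-3) ^ n)
        (∑ n ∈ Finset.range p, (az n : ℚ) / (-27) ^ n) ∧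
      pCong p 2 (∑ n ∈ Finset.range p, (az n : ℚ) / (-27) ^ n)
        (2 * (p : ℚ) - 2 * (x : ℚ) ^ 2)) := by
  have : Fact p.Prime := ⟨hp⟩
  have hm : p = 4 * (p / 4) + 1 := by omega
  have hpZ : Prime (p : ℤ) := Nat.prime_iff_prime_int.mp hp
  have hp1 : ¬ (p : ℤ) ∣ 1 := fun h => hpZ.not_isUnit (isUnit_of_dvd_one h)
  have hp2 : ¬ (p : ℤ) ∣ 2 := by
    intro h2
    have := (Nat.prime_dvd_prime_iff_eq hp Nat.prime_two).mp (Int.natCast_dvd_natCast.mp h2)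
    omega
  refine ⟨fun h12 x y h => ?_, fun h12 x y h => ?_⟩
  · have hpx := not_dvd_of_eq_sq_add_nine_mul_sq hp hp1 ((one_mul _).trans h)
    obtain ⟨e1, e2⟩ := pCong_sum_az_of_sq_add_sq hm (A := 2 * x ^ 2 - p) (B := 6 * (x * y))
      (by rw [h]; ring) (by omega) (by omega) (fun hd => by
        rw [dvd_sub_left dvd_rfl] at hd
        exact hpx (hpZ.dvd_of_dvd_pow ((hpZ.dvd_or_dvd hd).resolve_left hp2)))
    refine ⟨pCong_of_pCong hp e1 e2, ?_⟩
    push_cast at e2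
    rw [show 4 * (x : ℚ) ^ 2 - 2 * (p : ℚ) = 2 * (2 * (x : ℚ) ^ 2 - p) by ring]
    exact e2
  · have hpx := not_dvd_of_eq_sq_add_nine_mul_sq hp hp2 h
    obtain ⟨e1, e2⟩ := pCong_sum_az_of_sq_add_sq hm (A := p - x ^ 2) (B := 3 * (x * y))
      (by
        refine mul_left_cancel₀ (four_ne_zero (α := ℤ)) ?_
        linear_combination -4 * x ^ 2 * h)
      (by omega) (by omega) (fun hd => by
        rw [dvd_sub_right dvd_rfl] at hd
        exact hpx (hpZ.dvd_of_dvd_pow hd))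
    refine ⟨pCong_of_pCong hp e1 e2, ?_⟩
    push_cast at e2
    rw [show 2 * (p : ℚ) - 2 * (x : ℚ) ^ 2 = 2 * (p - (x : ℚ) ^ 2) by ring]
    exact e2
end
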